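/- arXiv:2006.04447 — 3 statements merged into one kernel-verified Lean document; each statement's English description precedes it below -/
import Mathlib

section
/- Let f : 𝔸 → 𝔸 be a positive twist map and z ∈ 𝔸. If there exists m ∈ ℕ* such that m·Torsion_m(f,z,v) < −1/2, then for every n ≥ m one has n·Torsionₙ(f,z,v) < −1/2 (i.e. once the total angular variation of the vertical vector drops below −1/2, it remains below −1/2 for all later times). -/
noncomputable section

open MeasureTheory Set Filter Topology Function

/-- The annulus `𝔸 = (ℝ/ℤ) × ℝ`. -/
abbrev Ann : Type := AddCircle (1 : ℝ) × ℝ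

/-- The plane `ℝ²`, universal cover of the annulus. -/
abbrev Pl : Type := ℝ × ℝ

/-- The covering projection `π : ℝ² → 𝔸`, `π(x,y) = (x + ℤ, y)`. -/
def pr : Pl → Ann := fun p => ((p.1 : AddCircle (1 : ℝ)), p.2)

/-- The vertical vector `v = (0,1)`. -/
def vv : Pl := (0, 1)

/-- Data of a `C¹` diffeomorphism `f` of the annulus, isotopic to the identity,
presented through a lifted isotopy `(Ft t)_{t ∈ [0,1]}` of `C¹` diffeomorphisms of the
plane commuting with the deck transformation, with `Ft 0 = id` and `Ft 1` a lift of `f`,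
whose derivatives depend continuously on `(t, z)`. -/
structure IsotopySetup where
  f : Ann → Ann
  Ft : ℝ → Pl → Pl
  lift_f : ∀ p, pr (Ft 1 p) = f (pr p)
  Ft_zero : Ft 0 = id
  Ft_periodic : ∀ t, ∀ p : Pl, Ft t (p + (1, 0)) = Ft t p + (1, 0)
  Ft_smooth : ∀ t ∈ Icc (0:ℝ) 1, ContDiff ℝ 1 (Ft t)
  Ft_diffeo : ∀ t ∈ Icc (0:ℝ) 1, ∃ G : Pl → Pl, ContDiff ℝ 1 G ∧
      Function.LeftInverse G (Ft t) ∧ Function.RightInverse G (Ft t)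
  Ft_cont : ContinuousOn (fun q : ℝ × Pl => Ft q.1 q.2) (Icc (0:ℝ) 1 ×ˢ univ)
  DFt_cont : ContinuousOn (fun q : ℝ × Pl => fderiv ℝ (Ft q.1) q.2) (Icc (0:ℝ) 1 ×ˢ univ)

namespace IsotopySetup

variable (S : IsotopySetup)

/-- The canonical lift `F : ℝ² → ℝ²` of `f`. -/
def F : Pl → Pl := S.Ft 1

/-- The extended linearized isotopy: for `t ≥ 0`, `D t p` is the derivative at `p` of the
extended isotopy `f_t`, determined by `Df_{n+s} = Df_s ∘ Df^n` for `n ∈ ℕ`, `s ∈ [0,1)`. -/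
def D (t : ℝ) (p : Pl) : Pl →L[ℝ] Pl :=
  (fderiv ℝ (S.Ft (Int.fract t)) (S.F^[⌊t⌋₊] p)).comp (fderiv ℝ (S.F^[⌊t⌋₊]) p)

/-- `S.AngleVar p w n a` : the total angular variation on `[0,n]` of the vector `w ∈ T_{π(p)}𝔸`
under the extended linearized isotopy equals `a`; that is, `a = n·Torsionₙ(f, π(p), w)`.
Here `Θ` is a continuous lift of the angle `≺(v, Df_t(z)w)` (so that the direction of
`Df_t(z)w` is `(−sin(2πΘ(t)), cos(2πΘ(t)))`). -/
def AngleVar (p w : Pl) (n : ℕ) (a : ℝ) : Prop :=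
  ∃ Θ : ℝ → ℝ, ContinuousOn Θ (Icc 0 (n:ℝ)) ∧
    (∀ t ∈ Icc (0:ℝ) (n:ℝ), ∃ r : ℝ, 0 < r ∧
      S.D t p w = r • (-Real.sin (2 * Real.pi * Θ t), Real.cos (2 * Real.pi * Θ t))) ∧
    a = Θ n - Θ 0

/-- `S.TorsionFin p w n τ` : the finite-time torsion `Torsionₙ(f, π(p), w)` equals `τ`. -/
def TorsionFin (p w : Pl) (n : ℕ) (τ : ℝ) : Prop :=
  ∃ a : ℝ, S.AngleVar p w n a ∧ τ = a / n

/-- The asymptotic torsion at the lifted point `p` exists and equals `L`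
(for every choice of nonzero tangent vector `w`). -/
def TorsionLift (p : Pl) (L : ℝ) : Prop :=
  ∀ w : Pl, w ≠ 0 → ∃ a : ℕ → ℝ, (∀ n : ℕ, 1 ≤ n → S.AngleVar p w n (a n)) ∧
    Tendsto (fun n : ℕ => a n / (n : ℝ)) atTop (nhds L)

/-- The asymptotic torsion at `z ∈ 𝔸` exists and equals `L`. -/
def Torsion (z : Ann) (L : ℝ) : Prop :=
  ∃ p : Pl, pr p = z ∧ S.TorsionLift p L

open Classical in
/-- The asymptotic torsion as a function on the annulus (defaulting to `0` where undefined). -/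
def torsionFun (z : Ann) : ℝ :=
  if h : ∃ L, S.Torsion z L then h.choose else 0

/-- The lifted point `p` has conjugate points: `n·Torsionₙ(f,z,v) = −k/2` for some `n,k ≥ 1`. -/
def ConjLift (p : Pl) : Prop :=
  ∃ n k : ℕ, 1 ≤ n ∧ 1 ≤ k ∧ ∃ a : ℝ, S.AngleVar p vv n a ∧ a = -(k : ℝ) / 2

/-- The lifted point `p` has over-conjugate points: `n·Torsionₙ(f,z,v) < −1/2` for some `n ≥ 1`. -/
def OverConjLift (p : Pl) : Prop :=
  ∃ n : ℕ, 1 ≤ n ∧ ∃ a : ℝ, S.AngleVar p vv n a ∧ a < -(1:ℝ) / 2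

/-- The point `z ∈ 𝔸` has conjugate points. -/
def Conj (z : Ann) : Prop := ∃ p : Pl, pr p = z ∧ S.ConjLift p

/-- The point `z ∈ 𝔸` has over-conjugate points. -/
def OverConj (z : Ann) : Prop := ∃ p : Pl, pr p = z ∧ S.OverConjLift p

/-- `f` is a positive twist map: for every `x`, the map `y ↦ p₁(F(x,y))` is an increasing
diffeomorphism of `ℝ` onto `ℝ`. -/
def PosTwist : Prop :=
  ∀ x : ℝ, StrictMono (fun y => (S.F (x, y)).1) ∧
    Function.Surjective (fun y => (S.F (x, y)).1) ∧
    ∀ y : ℝ, 0 < deriv (fun y => (S.F (x, y)).1) y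

/-- `f` has no conjugate points (linearized-dynamics formulation): for every `z ∈ ℝ²` and
`n ≥ 1`, the first component of `DFⁿ(z)(0,1)` does not vanish. -/
def NoConjPts : Prop :=
  ∀ p : Pl, ∀ n : ℕ, 1 ≤ n → ((fderiv ℝ (S.F^[n]) p) (0, 1)).1 ≠ 0

/-- `f` is exact symplectic: it preserves the Lebesgue measure and `F*(y dx) − y dx = dS`
for a `C¹` function `S : ℝ² → ℝ` with `S(x+1,y) = S(x,y)`. -/
def ExactSymplectic : Prop :=
  MeasurePreserving S.f volume volume ∧
  ∃ Sg : Pl → ℝ, ContDiff ℝ 1 Sg ∧ (∀ p : Pl, Sg (p + (1, 0)) = Sg p) ∧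
    ∀ p : Pl,
      fderiv ℝ Sg p (1, 0) = (S.F p).2 * (fderiv ℝ S.F p (1, 0)).1 - p.2 ∧
      fderiv ℝ Sg p (0, 1) = (S.F p).2 * (fderiv ℝ S.F p (0, 1)).1

end IsotopySetup

/-- `γ` is an essential curve of the annulus: a topological embedding of the circle which is
not homotopic to a constant map. -/
def EssentialCurve (γ : C(AddCircle (1:ℝ), Ann)) : Prop :=
  Topology.IsEmbedding γ ∧ ∀ z : Ann, ¬ γ.Homotopic (ContinuousMap.const _ z)

/-- An open subset of the annulus is essential if it contains an essential curve. -/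
def EssentialSet (U : Set Ann) : Prop :=
  ∃ γ : C(AddCircle (1:ℝ), Ann), EssentialCurve γ ∧ range γ ⊆ U

/-- `f` restricted to `U` is `C⁰`-integrable: `U` is the disjoint union of a family of
`f`-invariant images of essential curves. -/
def C0IntegrableOn (f : Ann → Ann) (U : Set Ann) : Prop :=
  ∃ (ι : Type) (γ : ι → C(AddCircle (1:ℝ), Ann)),
    (∀ i, EssentialCurve (γ i) ∧ f '' range (γ i) = range (γ i)) ∧
    (⋃ i, range (γ i)) = U ∧
    Pairwise (Disjoint on fun i => range (γ i))

/-- `ℤ`-iterates of a bijection (negative iterates through the inverse map). -/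
def iterZ {α : Type*} [Nonempty α] (f : α → α) : ℤ → α → α
  | Int.ofNat n => f^[n]
  | Int.negSucc n => (Function.invFun f)^[n + 1]

/-- `ℐ(f)`: the union of all `f`-invariant essential curves. -/
def invCurveUnion (f : Ann → Ann) : Set Ann :=
  ⋃ γ ∈ {γ : C(AddCircle (1:ℝ), Ann) | EssentialCurve γ ∧ f '' range γ = range γ}, range γ


/-! ### Auxiliary lemmas -/

lemma const_of_int_valued {g : ℝ → ℝ} {a b : ℝ} (_hab : a ≤ b) (hg : ContinuousOn g (Icc a b))
    (hi : ∀ t ∈ Icc a b, ∃ n : ℤ, g t = n) {x y : ℝ} (hx : x ∈ Icc a b) (hy : y ∈ Icc a b) :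
    g x = g y := by
  have hT : IsDiscrete (range (Int.cast : ℤ → ℝ)) := by
    rw [isDiscrete_iff_discreteTopology]
    exact Int.isClosedEmbedding_coe_real.isEmbedding.toHomeomorph.symm.isEmbedding.discreteTopology
  exact isPreconnected_Icc.constant_of_mapsTo hT hg
    (fun t ht => by obtain ⟨n, hn⟩ := hi t ht; exact ⟨n, hn.symm⟩) hx hy

lemma const_of_exp_eq_one {g : ℝ → ℂ} {a b : ℝ} (hab : a ≤ b) (hg : ContinuousOn g (Icc a b))
    (hi : ∀ t ∈ Icc a b, Complex.exp (g t) = 1) {x y : ℝ} (hx : x ∈ Icc a b) (hy : y ∈ Icc a b) :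
    g x = g y := by
  have key : ∀ t ∈ Icc a b, ∃ n : ℤ, g t = n * (2 * Real.pi * Complex.I) := fun t ht =>
    Complex.exp_eq_one_iff.1 (hi t ht)
  have h2 : (fun t => (g t).im / (2 * Real.pi)) x = (fun t => (g t).im / (2 * Real.pi)) y := by
    refine const_of_int_valued (g := fun t => (g t).im / (2 * Real.pi)) hab ?_ ?_ hx hy
    · exact (Complex.continuous_im.comp_continuousOn hg).div_const _
    · intro t ht
      obtain ⟨n, hn⟩ := key t ht
      refine ⟨n, ?_⟩
      have : (g t).im = n * (2 * Real.pi) := by rw [hn]; simp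
      rw [this]; field_simp
  have h3 : (g x).im = (g y).im := by
    have := Real.pi_pos
    field_simp at h2
    exact h2
  have hr : ∀ t ∈ Icc a b, (g t).re = 0 := by
    intro t ht
    obtain ⟨n, hn⟩ := key t ht
    rw [hn]; simp
  exact Complex.ext (by rw [hr x hx, hr y hy]) h3

/-- A path whose logarithm variation is given by the principal branch at both ends. -/
def GoodPath (γ : ℝ → ℂ) : Prop :=
  ∃ l : ℝ → ℂ, ContinuousOn l (Icc 0 1) ∧ (∀ t ∈ Icc (0:ℝ) 1, Complex.exp (l t) = γ t) ∧
    l 0 = Complex.log (γ 0) ∧ l 1 = Complex.log (γ 1)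

lemma goodPath_homotopy (H : ℝ × ℝ → ℂ) (hH : Continuous H)
    (h0 : ∀ t ∈ Icc (0:ℝ) 1, ∀ u ∈ Icc (0:ℝ) 1, H (t, u) ≠ 0)
    (hs0 : ∀ u ∈ Icc (0:ℝ) 1, H (0, u) ∈ Complex.slitPlane)
    (hs1 : ∀ u ∈ Icc (0:ℝ) 1, H (1, u) ∈ Complex.slitPlane)
    (hg : GoodPath (fun t => H (t, 1))) : GoodPath (fun t => H (t, 0)) := by
  have h01 : (0:ℝ) ≤ 1 := zero_le_one
  let c : ℝ → ℝ := fun t => (projIcc (0:ℝ) 1 h01 t : ℝ)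
  have hc : Continuous c := continuous_subtype_val.comp continuous_projIcc
  have hcm : ∀ t, c t ∈ Icc (0:ℝ) 1 := fun t => (projIcc (0:ℝ) 1 h01 t).2
  have hce : ∀ t ∈ Icc (0:ℝ) 1, c t = t := fun t ht => by
    simp only [c, projIcc_of_mem h01 ht]
  let K : C(ℝ × ℝ, ℂ) := ⟨fun q => H (c q.1, c q.2), by fun_prop⟩
  have hz : (0:ℝ) ∈ Icc (0:ℝ) 1 := by simp
  have ho : (1:ℝ) ∈ Icc (0:ℝ) 1 := by simp
  have hK : ∀ t ∈ Icc (0:ℝ) 1, ∀ u ∈ Icc (0:ℝ) 1, K (t, u) = H (t, u) := by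
    intro t ht u hu
    simp [K, hce t ht, hce u hu]
  have hex2 : ∃ L : C(ℝ × ℝ, ℂ), L (0, 0) = Complex.log (H (0, 0)) ∧
      ∀ q, Complex.exp (L q) = K q := by
    obtain ⟨L, ⟨hL1, hL2⟩, -⟩ := Complex.isCoveringMapOn_exp.existsUnique_continuousMap_lifts K
      (a₀ := ((0:ℝ), (0:ℝ))) (e₀ := Complex.log (H (0, 0)))
      (by rw [hK 0 hz 0 hz, Complex.exp_log (h0 _ hz _ hz)])
      (fun q => h0 _ (hcm q.1) _ (hcm q.2))
    exact ⟨L, hL1, fun q => congrFun hL2 q⟩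
  obtain ⟨L, hL0, hL⟩ := hex2
  have hLc := L.continuous
  have e0 : ∀ u ∈ Icc (0:ℝ) 1, L (0, u) = Complex.log (H (0, u)) := by
    intro u hu
    have := const_of_exp_eq_one (g := fun u => L (0, u) - Complex.log (H (0, u))) h01 ?_ ?_ hz hu
    · simp only [hL0, sub_self] at this
      exact (sub_eq_zero.1 this.symm)
    · refine ContinuousOn.sub (by fun_prop) (ContinuousOn.clog (by fun_prop) hs0)
    · intro t ht
      rw [Complex.exp_sub, hL, hK 0 hz t ht, Complex.exp_log (h0 _ hz _ ht),
        div_self (h0 _ hz _ ht)]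
  have e1 : L (1, 0) - Complex.log (H (1, 0)) = L (1, 1) - Complex.log (H (1, 1)) := by
    refine const_of_exp_eq_one (g := fun u => L (1, u) - Complex.log (H (1, u))) h01 ?_ ?_ hz ho
    · refine ContinuousOn.sub (by fun_prop) (ContinuousOn.clog (by fun_prop) hs1)
    · intro t ht
      rw [Complex.exp_sub, hL, hK 1 ho t ht, Complex.exp_log (h0 _ ho _ ht),
        div_self (h0 _ ho _ ht)]
  obtain ⟨l, hlc, hle, hl0, hl1⟩ := hg
  have e2 : L (0, 1) - l 0 = L (1, 1) - l 1 := by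
    refine const_of_exp_eq_one (g := fun t => L (t, 1) - l t) h01 ?_ ?_ hz ho
    · exact ContinuousOn.sub (by fun_prop) hlc
    · intro t ht
      rw [Complex.exp_sub, hL, hK t ht 1 ho, hle t ht, div_self (h0 _ ht _ ho)]
  have e3 : L (1, 0) = Complex.log (H (1, 0)) := by
    have := e0 1 ho
    rw [this, hl0, hl1, sub_self] at e2
    rw [← e2, sub_eq_zero] at e1
    exact e1
  refine ⟨fun t => L (t, 0), by fun_prop, ?_, hL0, e3⟩
  intro t ht
  rw [hL, hK t ht 0 hz]

namespace IsotopySetup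

variable (S : IsotopySetup)

/-- Clamped isotopy. -/
def Fc (t : ℝ) : Pl → Pl := S.Ft (projIcc (0:ℝ) 1 zero_le_one t : ℝ)

lemma Fc_eq {t : ℝ} (ht : t ∈ Icc (0:ℝ) 1) : S.Fc t = S.Ft t := by
  simp only [Fc, projIcc_of_mem zero_le_one ht]

lemma Fc_zero : S.Fc 0 = id := by rw [S.Fc_eq (by simp), S.Ft_zero]

lemma Fc_one : S.Fc 1 = S.F := by rw [S.Fc_eq (by simp)]; rfl

lemma Fc_smooth (t : ℝ) : ContDiff ℝ 1 (S.Fc t) := S.Ft_smooth _ (projIcc (0:ℝ) 1 zero_le_one t).2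

lemma Fc_inj (t : ℝ) : Function.Injective (S.Fc t) := by
  obtain ⟨G, -, hG, -⟩ := S.Ft_diffeo _ (projIcc (0:ℝ) 1 zero_le_one t).2
  exact hG.injective

lemma Fc_fderiv_inj (t : ℝ) (p w : Pl) (h : fderiv ℝ (S.Fc t) p w = 0) : w = 0 := by
  obtain ⟨G, hGs, hG, -⟩ := S.Ft_diffeo _ (projIcc (0:ℝ) 1 zero_le_one t).2
  have h1 : G ∘ S.Fc t = id := funext hG
  have h2 : fderiv ℝ (G ∘ S.Fc t) p = (fderiv ℝ G (S.Fc t p)).comp (fderiv ℝ (S.Fc t) p) :=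
    fderiv_comp p (hGs.differentiable one_ne_zero _) ((S.Fc_smooth t).differentiable one_ne_zero _)
  rw [h1, fderiv_id] at h2
  have h3 := congrArg (fun A => A w) h2
  simpa [h] using h3

lemma Fc_periodic (t : ℝ) (p : Pl) : S.Fc t (p + (1, 0)) = S.Fc t p + (1, 0) := S.Ft_periodic _ p

lemma Fc_cont : Continuous (fun q : ℝ × Pl => S.Fc q.1 q.2) := by
  have hc : Continuous fun q : ℝ × Pl => (((projIcc (0:ℝ) 1 zero_le_one q.1 : ℝ), q.2) : ℝ × Pl) :=
    ((continuous_subtype_val.comp continuous_projIcc).comp continuous_fst).prodMk continuous_snd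
  exact S.Ft_cont.comp_continuous hc (fun q => ⟨(projIcc (0:ℝ) 1 zero_le_one q.1).2, trivial⟩)

lemma DFc_cont : Continuous (fun q : ℝ × Pl => fderiv ℝ (S.Fc q.1) q.2) := by
  have hc : Continuous fun q : ℝ × Pl => (((projIcc (0:ℝ) 1 zero_le_one q.1 : ℝ), q.2) : ℝ × Pl) :=
    ((continuous_subtype_val.comp continuous_projIcc).comp continuous_fst).prodMk continuous_snd
  exact S.DFt_cont.comp_continuous hc (fun q => ⟨(projIcc (0:ℝ) 1 zero_le_one q.1).2, trivial⟩)

/-- Identification of the plane with `ℂ`. -/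
def toC (p : Pl) : ℂ := ⟨p.1, p.2⟩

lemma toC_cont : Continuous toC := Complex.equivRealProdCLM.symm.continuous

lemma toC_ne {p : Pl} (h : p ≠ 0) : toC p ≠ 0 := by
  intro h'
  apply h
  have h1 := congrArg Complex.re h'
  have h2 := congrArg Complex.im h'
  exact Prod.ext h1 h2

lemma deriv_fst (x y : ℝ) :
    deriv (fun y => (S.F (x, y)).1) y = (fderiv ℝ S.F (x, y) vv).1 := by
  have hF : HasFDerivAt S.F (fderiv ℝ S.F (x, y)) (x, y) := by
    rw [← S.Fc_one]
    exact ((S.Fc_smooth 1).differentiable one_ne_zero _).hasFDerivAt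
  have h1 : HasDerivAt (fun y : ℝ => ((x, y) : Pl)) vv y :=
    (hasDerivAt_const y x).prodMk (hasDerivAt_id y)
  have h2 := hF.comp_hasDerivAt y h1
  have h3 : HasDerivAt (fun y => (S.F (x, y)).1) (fderiv ℝ S.F (x, y) vv).1 y :=
    (ContinuousLinearMap.fst ℝ ℝ ℝ).hasFDerivAt.comp_hasDerivAt y h2
  exact h3.deriv

lemma exists_height (htwist : S.PosTwist) (x y : ℝ) :
    ∃ s : ℝ, 0 < s ∧ ∀ u ∈ Icc (0:ℝ) 1, (S.F (x, y)).1 < (S.F (x + u, y + s)).1 := by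
  have hFc : Continuous S.F := by rw [← S.Fc_one]; exact (S.Fc_smooth 1).continuous
  obtain ⟨s, hs⟩ := isCompact_Icc.elim_directed_cover (s := Icc (0:ℝ) 1)
    (fun s : ℝ => {u : ℝ | (S.F (x, y)).1 < (S.F (x + u, y + s)).1})
    (fun s => isOpen_lt continuous_const (by fun_prop))
    (by
      intro u _
      obtain ⟨y', hy'⟩ := (htwist (x + u)).2.1 ((S.F (x, y)).1 + 1)
      refine mem_iUnion.2 ⟨y' - y, ?_⟩
      simp only at hy'
      simp [hy'])
    (directed_of_isDirected_le (by
      intro s s' hss u hu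
      exact lt_of_lt_of_le hu ((htwist (x + u)).1.monotone (by linarith))))
  refine ⟨max s 1, by positivity, fun u hu => ?_⟩
  exact lt_of_lt_of_le (hs hu) ((htwist (x + u)).1.monotone (by have := le_max_left s 1; linarith))

lemma good_vertical (htwist : S.PosTwist) (z : Pl) :
    ∃ s : ℝ, 0 < s ∧ GoodPath (fun t => toC (s • fderiv ℝ (S.Fc t) z vv)) := by
  obtain ⟨s, hs, hsF⟩ := S.exists_height htwist z.1 z.2
  refine ⟨s, hs, ?_⟩
  have hF := S.Fc_cont
  have hDF := S.DFc_cont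
  have hC := toC_cont
  have hne : ∀ t : ℝ, ∀ w : Pl, w ≠ 0 → toC (S.Fc t (z + w) - S.Fc t z) ≠ 0 := by
    intro t w hw
    refine toC_ne (fun h => hw ?_)
    have := S.Fc_inj t (sub_eq_zero.1 h)
    simpa using this
  have mono : ∀ a : ℝ, 0 < a → (S.F z).1 < (S.F (z + (0, a))).1 := by
    intro a ha
    have := (htwist z.1).1 (show z.2 < z.2 + a by linarith)
    have e : z + ((0:ℝ), a) = (z.1, z.2 + a) := by ext <;> simp
    rw [e]; exact this
  -- piece 3
  have g3 : GoodPath (fun t => toC (S.Fc t (z + (1, s)) - S.Fc t z)) := by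
    have := goodPath_homotopy (fun q : ℝ × ℝ => toC (S.Fc q.1 (z + (1, (1 - q.2) * s)) - S.Fc q.1 z))
      (hC.comp ((hF.comp (by fun_prop : Continuous fun q : ℝ × ℝ => (q.1, z + ((1:ℝ), (1 - q.2) * s)))).sub
        (hF.comp (by fun_prop : Continuous fun q : ℝ × ℝ => (q.1, z))))) ?_ ?_ ?_ ?_
    · simpa using this
    · intro t _ u _
      exact hne t _ (fun h => by simpa using congrArg Prod.fst h)
    · intro u _
      left
      simp [S.Fc_zero, toC]
    · intro u hu
      left
      have e : z + ((1:ℝ), (1 - u) * s) = (z + (0, (1 - u) * s)) + (1, 0) := by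
        ext <;> simp
      have : (S.F z).1 ≤ (S.F (z + (0, (1 - u) * s))).1 := by
        rcases hu.2.eq_or_lt with h | h
        · have e : z + ((0:ℝ), (1 - u) * s) = z := by ext <;> simp [h]
          rw [e]
        · exact (mono _ (by nlinarith)).le
      simp only [e, S.Fc_periodic, S.Fc_one, toC, Prod.fst_sub, Prod.fst_add]
      linarith
    · refine ⟨fun _ => 0, continuousOn_const, ?_, ?_, ?_⟩
      · intro t _
        have e : z + ((1:ℝ), (1 - 1) * s) = z + (1, 0) := by ext <;> simp
        simp only [e, S.Fc_periodic, add_sub_cancel_left, Complex.exp_zero]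
        rfl
      all_goals
        have e : z + ((1:ℝ), (1 - 1) * s) = z + (1, 0) := by ext <;> simp
        have e2 : toC ((1:ℝ), (0:ℝ)) = 1 := rfl
        simp only [e, S.Fc_periodic, add_sub_cancel_left, e2, Complex.log_one]
  -- piece 2
  have g2 : GoodPath (fun t => toC (S.Fc t (z + (0, s)) - S.Fc t z)) := by
    refine goodPath_homotopy (fun q : ℝ × ℝ => toC (S.Fc q.1 (z + (q.2, s)) - S.Fc q.1 z))
      (hC.comp ((hF.comp (by fun_prop : Continuous fun q : ℝ × ℝ => (q.1, z + (q.2, s)))).sub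
        (hF.comp (by fun_prop : Continuous fun q : ℝ × ℝ => (q.1, z))))) ?_ ?_ ?_ g3
    · intro t _ u _
      exact hne t _ (fun h => hs.ne' (by simpa using congrArg Prod.snd h))
    · intro u _
      right
      simp [S.Fc_zero, toC, hs.ne']
    · intro u hu
      left
      simp only [S.Fc_one, toC, Prod.fst_sub]
      exact sub_pos.2 (hsF u hu)
  -- piece 1
  let I : ℝ × ℝ → Pl := fun q => ∫ σ in (0:ℝ)..1, fderiv ℝ (S.Fc q.1) (z + (0, σ * (q.2 * s))) (0, s)
  have hIc : Continuous I := by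
    refine intervalIntegral.continuous_parametric_intervalIntegral_of_continuous' ?_ 0 1
    exact (hDF.comp (by fun_prop : Continuous fun q : (ℝ × ℝ) × ℝ =>
      (q.1.1, z + ((0:ℝ), q.2 * (q.1.2 * s))))).clm_apply continuous_const
  have hI : ∀ t u : ℝ, u • I (t, u) = S.Fc t (z + (0, u * s)) - S.Fc t z := by
    intro t u
    have hd : ∀ σ ∈ uIcc (0:ℝ) 1, HasDerivAt (fun σ : ℝ => S.Fc t (z + (0, σ * (u * s))))
        (u • fderiv ℝ (S.Fc t) (z + (0, σ * (u * s))) (0, s)) σ := by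
      intro σ _
      have h1 : HasDerivAt (fun σ : ℝ => z + ((0:ℝ), σ * (u * s))) (0, u * s) σ := by
        have := (hasDerivAt_const σ (0:ℝ)).prodMk ((hasDerivAt_id σ).mul_const (u * s))
        simpa using this.const_add z
      have h2 := (((S.Fc_smooth t).differentiable one_ne_zero
        (z + ((0:ℝ), σ * (u * s)))).hasFDerivAt).comp_hasDerivAt σ h1
      have e : ((0:ℝ), u * s) = u • ((0:ℝ), s) := by ext <;> simp
      rw [e, map_smul] at h2
      exact h2
    have hcont : Continuous fun σ : ℝ => u • fderiv ℝ (S.Fc t) (z + (0, σ * (u * s))) (0, s) :=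
      ((hDF.comp (by fun_prop : Continuous fun σ : ℝ =>
        (t, z + ((0:ℝ), σ * (u * s))))).clm_apply continuous_const).const_smul u
    have := intervalIntegral.integral_eq_sub_of_hasDerivAt hd (hcont.intervalIntegrable 0 1)
    rw [intervalIntegral.integral_smul] at this
    have e : z + ((0:ℝ), (0:ℝ)) = z := by ext <;> simp
    simpa [I, e] using this
  have hI0 : ∀ t : ℝ, I (t, 0) = s • fderiv ℝ (S.Fc t) z vv := by
    intro t
    have e : z + ((0:ℝ), (0:ℝ)) = z := by ext <;> simp
    have e2 : ((0:ℝ), s) = s • vv := by ext <;> simp [vv]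
    simp [I, e, e2]
  have hI1 : ∀ t : ℝ, I (t, 1) = S.Fc t (z + (0, s)) - S.Fc t z := by
    intro t
    simpa using hI t 1
  have g1 : GoodPath (fun t => toC (I (t, 0))) := by
    refine goodPath_homotopy (fun q : ℝ × ℝ => toC (I q)) (hC.comp hIc) ?_ ?_ ?_ ?_
    · intro t _ u hu
      refine toC_ne (fun h => ?_)
      rcases eq_or_ne u 0 with rfl | hu0
      · rw [hI0] at h
        have h' := (smul_eq_zero.1 h).resolve_left hs.ne'
        have := S.Fc_fderiv_inj t z vv h'
        simpa [vv] using congrArg Prod.snd this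
      · have h2 := hI t u
        rw [h, smul_zero] at h2
        refine hne t (0, u * s) (fun h => ?_) ?_
        · have := congrArg Prod.snd h
          simp [hu0, hs.ne'] at this
        · rw [← h2]; rfl
    · intro u _
      right
      have : I (0, u) = (0, s) := by simp [I, S.Fc_zero]
      simp [this, toC, hs.ne']
    · intro u hu
      left
      change 0 < (I (1, u)).1
      rcases eq_or_ne u 0 with rfl | hu0
      · rw [hI0, S.Fc_one]
        have := (htwist z.1).2.2 z.2
        rw [S.deriv_fst] at this
        exact mul_pos hs this
      · have hup : 0 < u := lt_of_le_of_ne hu.1 hu0.symm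
        have h2 := congrArg Prod.fst (hI 1 u)
        have h3 := mono (u * s) (mul_pos hup hs)
        rw [S.Fc_one] at h2
        simp only [Prod.smul_fst, Prod.fst_sub, smul_eq_mul] at h2
        have : 0 < u * (I (1, u)).1 := by rw [h2]; linarith
        exact (pos_iff_pos_of_mul_pos this).1 hup
    · simpa only [hI1] using g2
  simpa only [hI0] using g1

lemma vertical_angle (htwist : S.PosTwist) (z : Pl) :
    ∃ φ : ℝ → ℝ, ContinuousOn φ (Icc 0 1) ∧ φ 0 = 0 ∧ φ 1 < 0 ∧ ∀ t ∈ Icc (0:ℝ) 1, ∃ r : ℝ, 0 < r ∧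
      fderiv ℝ (S.Ft t) z vv = r • (-Real.sin (2 * Real.pi * φ t), Real.cos (2 * Real.pi * φ t)) := by
  obtain ⟨s, hs, l, hlc, hle, hl0, hl1⟩ := S.good_vertical htwist z
  have hpi := Real.pi_pos
  refine ⟨fun t => ((l t).im - Real.pi / 2) / (2 * Real.pi), ?_, ?_, ?_, ?_⟩
  · exact ((Complex.continuous_im.comp_continuousOn hlc).sub continuousOn_const).div_const _
  · have e : toC (s • fderiv ℝ (S.Fc 0) z vv) = s * Complex.I := by
      apply Complex.ext <;> simp [toC, S.Fc_zero, vv]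
    simp only [hl0, e, Complex.log_im, Complex.arg_real_mul _ hs, Complex.arg_I]
    simp
  · have h1 : 0 < (toC (s • fderiv ℝ (S.Fc 1) z vv)).re := by
      have := (htwist z.1).2.2 z.2
      rw [S.deriv_fst] at this
      rw [S.Fc_one]
      exact mul_pos hs this
    have h2 := (Complex.abs_arg_lt_pi_div_two_iff.2 (Or.inl h1))
    simp only [hl1, Complex.log_im]
    exact div_neg_of_neg_of_pos (by linarith [(abs_lt.1 h2).2]) (by positivity)
  · intro t ht
    have h : Complex.exp (l t) = toC (s • fderiv ℝ (S.Fc t) z vv) := hle t ht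
    rw [S.Fc_eq ht] at h
    have ea : 2 * Real.pi * (((l t).im - Real.pi / 2) / (2 * Real.pi)) = (l t).im - Real.pi / 2 := by
      field_simp
    refine ⟨Real.exp (l t).re / s, by positivity, ?_⟩
    have h1 := congrArg Complex.re h
    have h2 := congrArg Complex.im h
    simp only [Complex.exp_re, Complex.exp_im, toC, Prod.smul_fst, Prod.smul_snd, smul_eq_mul] at h1 h2
    simp only [ea, Real.sin_sub_pi_div_two, Real.cos_sub_pi_div_two, neg_neg]
    ext
    · simp only [Prod.smul_fst, smul_eq_mul]; field_simp; linarith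
    · simp only [Prod.smul_snd, smul_eq_mul]; field_simp; linarith

lemma D_add (p : Pl) (k : ℕ) {s : ℝ} (hs : s ∈ Icc (0:ℝ) 1) :
    S.D (k + s) p = (fderiv ℝ (S.Ft s) (S.F^[k] p)).comp (fderiv ℝ (S.F^[k]) p) := by
  rcases hs.2.eq_or_lt with rfl | h1
  · have hd : Differentiable ℝ S.F := by
      rw [← S.Fc_one]; exact (S.Fc_smooth 1).differentiable one_ne_zero
    have e1 : ⌊(k:ℝ) + 1⌋₊ = k + 1 := by exact_mod_cast Nat.floor_natCast (R := ℝ) (k + 1)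
    have e2 : Int.fract ((k:ℝ) + 1) = 0 := by simp
    have hk : Differentiable ℝ S.F^[k] := hd.iterate k
    unfold D
    rw [e1, e2, S.Ft_zero, Function.iterate_succ', fderiv_id, ContinuousLinearMap.id_comp]
    exact fderiv_comp p (hd _) (hk _)
  · have e2 : Int.fract ((k:ℝ) + s) = s := by
      rw [Int.fract_natCast_add, Int.fract_eq_self.2 ⟨hs.1, h1⟩]
    have e1 : ⌊(k:ℝ) + s⌋₊ = k := by
      exact (Nat.floor_eq_iff (by have := hs.1; positivity)).2 ⟨by linarith [hs.1], by linarith⟩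
    unfold D
    rw [e1, e2]

lemma D_zero (p : Pl) : S.D 0 p = ContinuousLinearMap.id ℝ Pl := by
  unfold D
  simp [S.Ft_zero]

/-- Two angle representations of the same vector differ by an integer. -/
lemma angle_int {r r' x y : ℝ} (hr : 0 < r) (hr' : 0 < r')
    (h : r • ((-Real.sin (2 * Real.pi * x), Real.cos (2 * Real.pi * x)) : Pl)
      = r' • (-Real.sin (2 * Real.pi * y), Real.cos (2 * Real.pi * y))) :
    ∃ n : ℤ, x - y = n := by
  have h1 := congrArg Prod.fst h
  have h2 := congrArg Prod.snd h
  simp only [Prod.smul_fst, Prod.smul_snd, smul_eq_mul] at h1 h2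
  have hsx := Real.sin_sq_add_cos_sq (2 * Real.pi * x)
  have hsy := Real.sin_sq_add_cos_sq (2 * Real.pi * y)
  have hc : Real.cos (2 * Real.pi * x - 2 * Real.pi * y) = 1 := by
    rw [Real.cos_sub]
    have : r ^ 2 = r' ^ 2 := by
      calc r ^ 2 = (r * -Real.sin (2 * Real.pi * x)) ^ 2 + (r * Real.cos (2 * Real.pi * x)) ^ 2 := by
            linear_combination (-r ^ 2) * hsx
        _ = r' ^ 2 := by rw [h1, h2]; linear_combination (r' ^ 2) * hsy
    have hrr : r = r' := by
      exact (pow_left_inj₀ hr.le hr'.le two_ne_zero).1 this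
    subst hrr
    have a1 := mul_left_cancel₀ hr.ne' h1
    have a2 := mul_left_cancel₀ hr.ne' h2
    rw [a2, neg_inj.1 a1]; linear_combination hsy
  obtain ⟨n, hn⟩ := (Real.cos_eq_one_iff _).1 hc
  refine ⟨n, ?_⟩
  have := Real.pi_pos
  have h3 : (2 * Real.pi) * (x - y) = (2 * Real.pi) * n := by linarith
  exact mul_left_cancel₀ (by positivity) h3

/-- The comparison argument over one period. -/
lemma one_step (htwist : S.PosTwist) (q w : Pl) (Θ : ℝ → ℝ) (hc : ContinuousOn Θ (Icc 0 1))
    (hΘ : ∀ t ∈ Icc (0:ℝ) 1, ∃ r : ℝ, 0 < r ∧ fderiv ℝ (S.Ft t) q w =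
      r • (-Real.sin (2 * Real.pi * Θ t), Real.cos (2 * Real.pi * Θ t)))
    (h0 : Θ 0 < -1/2) : Θ 1 < -1/2 := by
  obtain ⟨φ, hφc, hφ0, hφ1, hφ⟩ := S.vertical_angle htwist q
  by_contra hcon
  push Not at hcon
  have hz : (0:ℝ) ∈ Icc (0:ℝ) 1 := by simp
  have ho : (1:ℝ) ∈ Icc (0:ℝ) 1 := by simp
  have hψc : ContinuousOn (fun t => Θ t - φ t) (Icc 0 1) := hc.sub hφc
  -- the set of intermediate values
  have ivt : ∀ c : ℝ, Θ 0 ≤ c → c ≤ -1/2 → ∃ t ∈ Icc (0:ℝ) 1, Θ t - φ t = c := by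
    intro c h1 h2
    have := intermediate_value_Icc zero_le_one hψc
    exact this ⟨by simpa [hφ0] using h1, by linarith⟩
  -- vanishing of the sine forces the vectors to be parallel
  have par : ∀ t ∈ Icc (0:ℝ) 1, Real.sin (2 * Real.pi * (Θ t - φ t)) = 0 → ∃ c : ℝ, w = c • vv := by
    intro t ht hsin
    obtain ⟨r, hr, h1⟩ := hΘ t ht
    obtain ⟨r', hr', h2⟩ := hφ t ht
    set A := 2 * Real.pi * Θ t
    set B := 2 * Real.pi * φ t
    have hAB : Real.sin A * Real.cos B - Real.cos A * Real.sin B = 0 := by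
      rw [← Real.sin_sub, ← hsin]; congr 1; simp only [A, B]; ring
    refine ⟨r / r' * (Real.cos A * Real.cos B + Real.sin A * Real.sin B), ?_⟩
    rw [← sub_eq_zero]
    apply S.Fc_fderiv_inj t q
    rw [S.Fc_eq ht, map_sub, map_smul, h1, h2]
    have hB := Real.sin_sq_add_cos_sq B
    ext
    · simp only [Prod.fst_sub, Prod.smul_fst, smul_eq_mul, Prod.fst_zero]
      field_simp
      linear_combination (-r * Real.cos B) * hAB + r * Real.sin A * hB
    · simp only [Prod.snd_sub, Prod.smul_snd, smul_eq_mul, Prod.snd_zero]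
      field_simp
      linear_combination (-r * Real.sin B) * hAB - r * Real.cos A * hB
  have par' : ∀ c : ℝ, w = c • vv → ∀ t ∈ Icc (0:ℝ) 1, Real.sin (2 * Real.pi * (Θ t - φ t)) = 0 := by
    intro c hw t ht
    obtain ⟨r, hr, h1⟩ := hΘ t ht
    obtain ⟨r', hr', h2⟩ := hφ t ht
    rw [hw, map_smul, h2] at h1
    have a1 := congrArg Prod.fst h1
    have a2 := congrArg Prod.snd h1
    simp only [Prod.smul_fst, Prod.smul_snd, smul_eq_mul] at a1 a2
    rw [mul_sub, Real.sin_sub]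
    have : r * (Real.sin (2 * Real.pi * Θ t) * Real.cos (2 * Real.pi * φ t) -
      Real.cos (2 * Real.pi * Θ t) * Real.sin (2 * Real.pi * φ t)) = 0 := by
      linear_combination (Real.cos (2 * Real.pi * φ t)) * a1 + Real.sin (2 * Real.pi * φ t) * a2
    exact (mul_eq_zero.1 this).resolve_left hr.ne'
  obtain ⟨t, ht, hte⟩ := ivt (-1/2) h0.le le_rfl
  obtain ⟨c, hw⟩ := par t ht (by
    rw [hte, show 2 * Real.pi * (-1/2) = -Real.pi by ring]; simp)
  have hlt : max (Θ 0) (-3/4) < -1/2 := max_lt h0 (by norm_num)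
  obtain ⟨t', ht', hte'⟩ := ivt (max (Θ 0) (-3/4)) (le_max_left _ _) hlt.le
  have hsin := par' c hw t' ht'
  rw [hte'] at hsin
  have hpi := Real.pi_pos
  have hge := le_max_right (Θ 0) (-3/4)
  have : 0 < Real.sin (2 * Real.pi * max (Θ 0) (-3/4) + 2 * Real.pi) :=
    Real.sin_pos_of_pos_of_lt_pi (by nlinarith) (by nlinarith)
  rw [Real.sin_add_two_pi] at this
  exact this.ne' hsin

end IsotopySetup

/-- For a positive twist map, if the total angular variation of the vertical
vector drops below `−1/2` at time `m`, then it remains below `−1/2` at every later time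
`n ≥ m`. -/
theorem statement17 (S : IsotopySetup) (htwist : S.PosTwist) (p : Pl)
    (m : ℕ) (hm : 1 ≤ m) (a : ℝ) (ha : S.AngleVar p vv m a) (haneg : a < -(1:ℝ)/2) :
    ∀ n : ℕ, m ≤ n → ∀ b : ℝ, S.AngleVar p vv n b → b < -(1:ℝ)/2 := by
  have hpi := Real.pi_pos
  rintro n hmn b ⟨Θ, hΘc, hΘ, rfl⟩
  obtain ⟨Θ', hΘc', hΘ', rfl⟩ := ha
  have hmn' : (m:ℝ) ≤ n := by exact_mod_cast hmn
  have hm0 : (0:ℝ) ≤ m := by positivity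
  have hsub : Icc (0:ℝ) m ⊆ Icc (0:ℝ) n := Icc_subset_Icc_right hmn'
  -- the two lifts have the same variation on `[0, m]`
  have hbase : Θ m - Θ 0 < -(1:ℝ)/2 := by
    have := const_of_int_valued (g := fun t => Θ t - Θ' t) hm0 ((hΘc.mono hsub).sub hΘc')
      (fun t ht => by
        obtain ⟨r, hr, h1⟩ := hΘ t (hsub ht)
        obtain ⟨r', hr', h2⟩ := hΘ' t ht
        exact IsotopySetup.angle_int hr hr' (h1.symm.trans h2))
      (left_mem_Icc.2 hm0) (right_mem_Icc.2 hm0)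
    linarith
  -- the initial angle is an integer
  have hint : ∃ N : ℤ, Θ 0 = N := by
    obtain ⟨r, hr, h1⟩ := hΘ 0 (left_mem_Icc.2 (hm0.trans hmn'))
    rw [S.D_zero] at h1
    obtain ⟨N, hN⟩ := IsotopySetup.angle_int (r := r) (r' := 1) (x := Θ 0) (y := 0) hr one_pos
      (by rw [← h1]; simp [vv])
    exact ⟨N, by simpa using hN⟩
  obtain ⟨N, hN⟩ := hint
  have hind : ∀ k : ℕ, m ≤ k → k ≤ n → Θ k - Θ 0 < -(1:ℝ)/2 := by
    intro k hk
    induction k, hk using Nat.le_induction with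
    | base => exact fun _ => hbase
    | succ k hk ih =>
      intro hkn
      have hkn' : (k:ℝ) + 1 ≤ n := by exact_mod_cast hkn
      have hk0 : (0:ℝ) ≤ k := by positivity
      have hmem : ∀ t ∈ Icc (0:ℝ) 1, (k:ℝ) + t ∈ Icc (0:ℝ) n := fun t ht =>
        ⟨by linarith [ht.1], by linarith [ht.2]⟩
      have := S.one_step htwist (S.F^[k] p) (fderiv ℝ (S.F^[k]) p vv)
        (fun t => Θ (k + t) - N) ?_ ?_ ?_
      · rw [hN]; push_cast; exact this
      · exact (hΘc.comp (by fun_prop) hmem).sub continuousOn_const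
      · intro t ht
        obtain ⟨r, hr, h1⟩ := hΘ _ (hmem t ht)
        refine ⟨r, hr, ?_⟩
        rw [S.D_add p k ht] at h1
        have e : 2 * Real.pi * (Θ (k + t) - N) = 2 * Real.pi * Θ (k + t) - N * (2 * Real.pi) := by
          ring
        rw [e, Real.sin_sub_int_mul_two_pi, Real.cos_sub_int_mul_two_pi]
        exact h1
      · have := ih (by omega)
        simpa [← hN] using this
  exact hind n hmn le_rfl

end
end

section
/- Let f : 𝔸 → 𝔸 be a C¹ diffeomorphism isotopic to the identity admitting an f-invariant Borel probability measure μ on 𝔸 with compact support. Then for μ-almost every z ∈ 𝔸 the asymptotic torsion Torsion(f,z) = lim_{n→∞} Torsionₙ(f,z,w) exists (and is independent of the nonzero tangent vector w). -/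
noncomputable section

open MeasureTheory Set Filter Topology Function

namespace TorsionAux

section Birkhoff

variable {X : Type*}

/-- Running maximum of the Birkhoff sums. -/
def maxSum (T : X → X) (g : X → ℝ) : ℕ → X → ℝ
  | 0, _ => 0
  | n + 1, x => max 0 (g x + maxSum T g n (T x))

lemma maxSum_nonneg (T : X → X) (g : X → ℝ) (n : ℕ) (x : X) : 0 ≤ maxSum T g n x := by
  cases n with
  | zero => exact le_refl _
  | succ n => exact le_max_left _ _

lemma maxSum_le_succ (T : X → X) (g : X → ℝ) (n : ℕ) (x : X) :
    maxSum T g n x ≤ maxSum T g (n + 1) x := by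
  induction n generalizing x with
  | zero => exact maxSum_nonneg _ _ _ _
  | succ n ih =>
    change max 0 (g x + maxSum T g n (T x)) ≤ max 0 (g x + maxSum T g (n + 1) (T x))
    have := ih (T x)
    gcongr

lemma maxSum_mono (T : X → X) (g : X → ℝ) (x : X) : Monotone (fun n => maxSum T g n x) :=
  monotone_nat_of_le_succ fun n => maxSum_le_succ T g n x

lemma birkhoffSum_le_maxSum (T : X → X) (g : X → ℝ) (n : ℕ) (x : X) :
    birkhoffSum T g n x ≤ maxSum T g n x := by
  induction n generalizing x with
  | zero => simp [maxSum]
  | succ n ih =>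
    rw [birkhoffSum_succ']
    exact le_trans (by have := ih (T x); linarith) (le_max_right _ _)

lemma maxSum_le (T : X → X) (g : X → ℝ) {C : ℝ} (hC : ∀ x, |g x| ≤ C) (n : ℕ) (x : X) :
    maxSum T g n x ≤ n * C := by
  have hC0 : 0 ≤ C := (abs_nonneg _).trans (hC x)
  induction n generalizing x with
  | zero => simp [maxSum]
  | succ n ih =>
    have h1 := ih (T x)
    have h2 := (abs_le.1 (hC x)).2
    refine max_le (by positivity) ?_
    push_cast
    linarith

lemma maxSum_sub_le (T : X → X) (g : X → ℝ) (n : ℕ) (x : X) :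
    maxSum T g n x - maxSum T g n (T x) ≤ {y | 0 < maxSum T g n y}.indicator g x := by
  by_cases hx : 0 < maxSum T g n x
  · rw [indicator_of_mem (by exact hx)]
    cases n with
    | zero => simp [maxSum] at hx
    | succ n =>
      have h1 := maxSum_le_succ T g n (T x)
      have h2 : maxSum T g (n + 1) x = g x + maxSum T g n (T x) := by
        change max 0 (g x + maxSum T g n (T x)) = _
        change 0 < max 0 (g x + maxSum T g n (T x)) at hx
        apply max_eq_right
        by_contra hcon
        rw [max_eq_left (not_le.1 hcon).le] at hx
        exact lt_irrefl _ hx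
      linarith
  · rw [indicator_of_notMem (by exact hx)]
    have := maxSum_nonneg T g n (T x)
    linarith [not_lt.1 hx]

variable [MeasurableSpace X]

lemma measurable_maxSum {T : X → X} {g : X → ℝ} (hT : Measurable T) (hg : Measurable g) (n : ℕ) :
    Measurable (maxSum T g n) := by
  induction n with
  | zero => exact measurable_const
  | succ n ih => exact measurable_const.max (hg.add (ih.comp hT))

lemma integral_nonneg_of_maxSum {ν : Measure X} [IsFiniteMeasure ν] {T : X → X}
    (hT : MeasurePreserving T ν ν) {g : X → ℝ} (hg : Measurable g) {C : ℝ}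
    (hC : ∀ x, |g x| ≤ C) (hpos : ∀ᵐ x ∂ν, ∃ n, 0 < birkhoffSum T g n x) :
    0 ≤ ∫ x, g x ∂ν := by
  have hms : ∀ n, MeasurableSet {y | 0 < maxSum T g n y} := fun n =>
    measurableSet_lt measurable_const (measurable_maxSum hT.measurable hg n)
  have hgi : Integrable g ν :=
    Integrable.of_bound hg.aestronglyMeasurable C (Eventually.of_forall hC)
  have hMi : ∀ n, Integrable (maxSum T g n) ν := fun n =>
    Integrable.of_bound (measurable_maxSum hT.measurable hg n).aestronglyMeasurable (n * C)
      (Eventually.of_forall fun x => by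
        rw [Real.norm_eq_abs, abs_of_nonneg (maxSum_nonneg _ _ _ _)]
        exact maxSum_le T g hC n x)
  have hn : ∀ n, 0 ≤ ∫ x, {y | 0 < maxSum T g n y}.indicator g x ∂ν := by
    intro n
    have h1 : ∫ x, maxSum T g n (T x) ∂ν = ∫ x, maxSum T g n x ∂ν :=
      integral_comp_of_map hT hg n
    have h2 : Integrable (fun x => maxSum T g n (T x)) ν :=
      hT.integrable_comp_of_integrable (hMi n)
    calc (0 : ℝ) = ∫ x, (maxSum T g n x - maxSum T g n (T x)) ∂ν := by
          rw [integral_sub (hMi n) h2, h1, sub_self]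
      _ ≤ _ := integral_mono ((hMi n).sub h2) (hgi.indicator (hms n)) (maxSum_sub_le T g n)
  have hlim : Tendsto (fun n => ∫ x, {y | 0 < maxSum T g n y}.indicator g x ∂ν) atTop
      (𝓝 (∫ x, g x ∂ν)) := by
    refine tendsto_integral_of_dominated_convergence (fun x => |g x|)
      (fun n => (hg.indicator (hms n)).aestronglyMeasurable) hgi.abs
      (fun n => Eventually.of_forall fun x => ?_) ?_
    · exact norm_indicator_le_norm_self g x
    · filter_upwards [hpos] with x hx
      obtain ⟨m, hm⟩ := hx
      refine tendsto_const_nhds.congr' ?_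
      filter_upwards [eventually_ge_atTop m] with n hn
      rw [indicator_of_mem]
      exact lt_of_lt_of_le (hm.trans_le (birkhoffSum_le_maxSum T g m x)) (maxSum_mono T g x hn)
  exact ge_of_tendsto' hlim hn
where
  integral_comp_of_map {ν : Measure X} {T : X → X}
    (hT : MeasurePreserving T ν ν) {g : X → ℝ} (hg : Measurable g) (n : ℕ) :
    ∫ x, maxSum T g n (T x) ∂ν = ∫ x, maxSum T g n x ∂ν := by
    have := integral_map (μ := ν) hT.measurable.aemeasurable
      (f := maxSum T g n) (measurable_maxSum hT.measurable hg n).aestronglyMeasurable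
    rw [hT.map_eq] at this
    exact this.symm

/-- Points whose Birkhoff averages have upper limit larger than `b`. -/
def upSet (T : X → X) (g : X → ℝ) (b : ℝ) : Set X :=
  ⋃ c : {c : ℚ // b < (c : ℝ)}, {x | ∃ᶠ n in atTop, ((c : ℚ) : ℝ) < birkhoffAverage ℝ T g n x}

lemma measurable_birkhoffAverage' {T : X → X} {g : X → ℝ} (hT : Measurable T) (hg : Measurable g)
    (n : ℕ) : Measurable (birkhoffAverage ℝ T g n) := by
  have : Measurable (fun x => birkhoffSum T g n x) := by
    unfold birkhoffSum
    exact Finset.measurable_sum _ fun i _ => hg.comp (hT.iterate i)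
  exact this.const_smul ((n : ℝ)⁻¹)

lemma measurableSet_upSet {T : X → X} {g : X → ℝ} (hT : Measurable T) (hg : Measurable g) (b : ℝ) :
    MeasurableSet (upSet T g b) := by
  refine MeasurableSet.iUnion fun c => ?_
  exact measurableSet_setOf_frequently c
where
  measurableSet_setOf_frequently (c : {c : ℚ // b < (c : ℝ)}) :
      MeasurableSet {x | ∃ᶠ n in atTop, ((c : ℚ) : ℝ) < birkhoffAverage ℝ T g n x} := by
    have : {x | ∃ᶠ n in atTop, ((c : ℚ) : ℝ) < birkhoffAverage ℝ T g n x} =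
        ⋂ N : ℕ, ⋃ n : ℕ, ⋃ _ : N ≤ n, {x | ((c : ℚ) : ℝ) < birkhoffAverage ℝ T g n x} := by
      ext x
      simp [frequently_atTop]
    rw [this]
    exact MeasurableSet.iInter fun N => MeasurableSet.iUnion fun n => MeasurableSet.iUnion fun _ =>
      measurableSet_lt measurable_const (measurable_birkhoffAverage' hT hg n)

lemma frequently_shift {u v : ℕ → ℝ} {b : ℝ} (huv : Tendsto (fun n => v n - u n) atTop (𝓝 0))
    (h : ∃ c : ℚ, b < c ∧ ∃ᶠ n in atTop, (c : ℝ) < u n) :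
    ∃ c : ℚ, b < c ∧ ∃ᶠ n in atTop, (c : ℝ) < v n := by
  obtain ⟨c, hbc, hc⟩ := h
  obtain ⟨d, hd1, hd2⟩ := exists_rat_btwn hbc
  refine ⟨d, hd1, ?_⟩
  have hev : ∀ᶠ n in atTop, (d : ℝ) - c < v n - u n :=
    huv.eventually (lt_mem_nhds (by linarith))
  exact (hc.and_eventually hev).mono fun n hn => by linarith [hn.1, hn.2]

lemma mem_upSet {T : X → X} {g : X → ℝ} {b : ℝ} {x : X} :
    x ∈ upSet T g b ↔ ∃ c : ℚ, b < c ∧ ∃ᶠ n in atTop, (c : ℝ) < birkhoffAverage ℝ T g n x := by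
  simp [upSet]

lemma preimage_upSet (T : X → X) {g : X → ℝ} {C : ℝ} (hC : ∀ x, |g x| ≤ C) (b : ℝ) :
    T ⁻¹' upSet T g b = upSet T g b := by
  have hb : Bornology.IsBounded (range g) := by
    refine isBounded_iff_forall_norm_le.2 ⟨C, ?_⟩
    rintro _ ⟨x, rfl⟩
    exact hC x
  ext x
  have h := tendsto_birkhoffAverage_apply_sub_birkhoffAverage' ℝ hb T x
  rw [mem_preimage, mem_upSet, mem_upSet]
  constructor
  · refine frequently_shift ?_
    simpa using h.neg
  · exact frequently_shift h

lemma le_integral_of_subset_upSet {μ : Measure X} [IsFiniteMeasure μ] {T : X → X}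
    (hT : MeasurePreserving T μ μ) {g : X → ℝ} (hg : Measurable g) {C : ℝ}
    (hC : ∀ x, |g x| ≤ C) {b : ℝ} {E : Set X} (hE : MeasurableSet E) (hTE : T ⁻¹' E = E)
    (hEU : E ⊆ upSet T g b) : b * μ.real E ≤ ∫ x in E, g x ∂μ := by
  have hTr : MeasurePreserving T (μ.restrict E) (μ.restrict E) := by
    have := hT.restrict_preimage hE
    rwa [hTE] at this
  have hgi : Integrable g (μ.restrict E) :=
    Integrable.of_bound hg.aestronglyMeasurable C (Eventually.of_forall hC)
  have key := integral_nonneg_of_maxSum hTr (g := fun x => g x - b) (hg.sub_const b)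
    (C := C + |b|) (fun x => (abs_sub _ _).trans (by have := hC x; linarith)) ?_
  · rw [integral_sub hgi (integrable_const _)] at key
    simp only [integral_const, smul_eq_mul, measureReal_restrict_apply_univ] at key
    linarith
  · refine (ae_restrict_iff' hE).2 (Eventually.of_forall fun x hx => ?_)
    obtain ⟨c, hbc, hc⟩ := mem_upSet.1 (hEU hx)
    obtain ⟨n, hn, hn1⟩ := (hc.and_eventually (eventually_ge_atTop 1)).exists
    refine ⟨n, ?_⟩
    have hn0 : (0 : ℝ) < n := by exact_mod_cast hn1
    have h2 : birkhoffSum T (fun x => g x - b) n x = birkhoffSum T g n x - n * b := by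
      simp [birkhoffSum, Finset.sum_sub_distrib]
    rw [h2]
    have h3 : b < birkhoffAverage ℝ T g n x := hbc.trans hn
    rw [birkhoffAverage, smul_eq_mul, inv_mul_eq_div, lt_div_iff₀ hn0] at h3
    linarith

/-- Birkhoff's pointwise ergodic theorem for bounded functions. -/
lemma birkhoff_bounded {μ : Measure X} [IsFiniteMeasure μ] {T : X → X}
    (hT : MeasurePreserving T μ μ) {g : X → ℝ} (hg : Measurable g) {C : ℝ}
    (hC : ∀ x, |g x| ≤ C) :
    ∀ᵐ x ∂μ, ∃ c, Tendsto (fun n => birkhoffAverage ℝ T g n x) atTop (𝓝 c) := by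
  have hC' : ∀ x, |(-g) x| ≤ C := fun x => by simpa using hC x
  have hnull : ∀ a b : ℚ, a < b → μ (upSet T g b ∩ upSet T (-g) (-a)) = 0 := by
    intro a b hab
    set E := upSet T g b ∩ upSet T (-g) (-a) with hEdef
    have hE : MeasurableSet E := (measurableSet_upSet hT.measurable hg _).inter
      (measurableSet_upSet hT.measurable hg.neg _)
    have hTE : T ⁻¹' E = E := by
      rw [hEdef, preimage_inter, preimage_upSet T hC, preimage_upSet T hC']
    have h1 := le_integral_of_subset_upSet hT hg hC hE hTE inter_subset_left
    have h2 := le_integral_of_subset_upSet hT hg.neg hC' hE hTE inter_subset_right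
    simp only [Pi.neg_apply, integral_neg] at h2
    have hab' : (a : ℝ) < b := by exact_mod_cast hab
    have h3 : μ.real E = 0 := by
      have h4 : 0 ≤ μ.real E := measureReal_nonneg
      nlinarith
    exact (measureReal_eq_zero_iff).1 h3
  have hall : ∀ᵐ x ∂μ, ∀ a b : ℚ, a < b → x ∉ upSet T g b ∩ upSet T (-g) (-a) := by
    rw [ae_all_iff]; intro a
    rw [ae_all_iff]; intro b
    by_cases hab : a < b
    · have := measure_eq_zero_iff_ae_notMem.1 (hnull a b hab)
      filter_upwards [this] with x hx _ using hx
    · exact Eventually.of_forall fun x h => absurd h hab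
  filter_upwards [hall] with x hx
  have hbd : ∀ n, |birkhoffAverage ℝ T g n x| ≤ C := by
    intro n
    have hC0 : 0 ≤ C := (abs_nonneg _).trans (hC x)
    rw [birkhoffAverage, smul_eq_mul, inv_mul_eq_div, abs_div, Nat.abs_cast]
    refine div_le_of_le_mul₀ (Nat.cast_nonneg _) hC0 ?_
    unfold birkhoffSum
    refine (Finset.abs_sum_le_sum_abs _ _).trans ?_
    refine (Finset.sum_le_sum fun i _ => hC _).trans ?_
    simp [mul_comm]
  refine tendsto_of_no_upcrossings (s := range ((↑) : ℚ → ℝ)) Rat.denseRange_cast ?_ ?_ ?_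
  · rintro _ ⟨a, rfl⟩ _ ⟨b, rfl⟩ hab ⟨h1, h2⟩
    obtain ⟨a', ha1, ha2⟩ := exists_rat_btwn hab
    obtain ⟨b', hb1, hb2⟩ := exists_rat_btwn ha2
    refine hx a' b' (by exact_mod_cast hb1) ⟨?_, ?_⟩
    · exact mem_upSet.2 ⟨b, hb2, h2⟩
    · refine mem_upSet.2 ⟨-a, ?_, h1.mono fun n hn => ?_⟩
      · push_cast; linarith
      · have : birkhoffAverage ℝ T (-g) n x = - birkhoffAverage ℝ T g n x := by
          simp [birkhoffAverage, birkhoffSum]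
        rw [this]; push_cast; linarith
  · exact isBoundedUnder_of ⟨C, fun n => (abs_le.1 (hbd n)).2⟩
  · exact isBoundedUnder_of ⟨-C, fun n => (abs_le.1 (hbd n)).1⟩

end Birkhoff


section Quasi

lemma exists_tendsto_of_approx {u : ℕ → ℝ}
    (h : ∀ ε > 0, ∃ c : ℝ, ∀ᶠ n in atTop, |u n - c| ≤ ε) : ∃ L, Tendsto u atTop (𝓝 L) := by
  apply cauchySeq_tendsto_of_complete
  rw [Metric.cauchySeq_iff]
  intro ε hε
  obtain ⟨c, hc⟩ := h (ε / 3) (by positivity)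
  obtain ⟨N, hN⟩ := eventually_atTop.1 hc
  refine ⟨N, fun m hm n hn => ?_⟩
  have h1 := hN m hm
  have h2 := hN n hn
  rw [Real.dist_eq]
  rw [abs_le] at h1 h2
  rw [abs_lt]
  constructor <;> linarith [h1.1, h1.2, h2.1, h2.2]

lemma tendsto_natDiv_div {k : ℕ} (hk : 0 < k) :
    Tendsto (fun n : ℕ => ((n / k : ℕ) : ℝ) / n) atTop (𝓝 (1 / k)) := by
  have h := (tendsto_nat_floor_mul_div_atTop (R := ℝ) (a := 1 / (k : ℝ)) (by positivity)).comp
    (tendsto_natCast_atTop_atTop (R := ℝ))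
  refine h.congr fun n => ?_
  simp only [Function.comp]
  congr 2
  rw [one_div, inv_mul_eq_div, Nat.floor_div_eq_div]

/-- Deterministic part: a quasi-additive sequence along an orbit. -/
lemma quasi_approx {X : Type*} {T : X → X} {A : ℕ → X → ℝ} (hA0 : ∀ x, A 0 x = 0)
    (hq : ∀ n m x, |A (n + m) x - A n x - A m (T^[n] x)| ≤ 1) {x : X}
    {B : ℕ → ℝ} (hB : ∀ r n, |A r (T^[n] x)| ≤ B r) {k : ℕ} (hk : 0 < k) {c : ℝ}
    (hc : Tendsto (fun n => (∑ j ∈ Finset.range n, A k (T^[k * j] x)) / (n : ℝ)) atTop (𝓝 c)) :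
    ∀ᶠ n : ℕ in atTop, |A n x / n - c / k| ≤ 3 / k := by
  have hk' : (0 : ℝ) < k := by exact_mod_cast hk
  set s : ℕ → ℝ := fun n => ∑ j ∈ Finset.range n, A k (T^[k * j] x) with hs
  have h1 : ∀ n : ℕ, |A (k * n) x - s n| ≤ n := by
    intro n
    induction n with
    | zero => simp [hs, hA0]
    | succ n ih =>
      have h2 := hq (k * n) k x
      have h3 : s (n + 1) = s n + A k (T^[k * n] x) := by simp [hs, Finset.sum_range_succ]
      rw [h3, mul_add, mul_one]
      push_cast
      rw [abs_le] at *
      constructor <;> linarith [h2.1, h2.2, ih.1, ih.2]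
  obtain ⟨R, hR⟩ : ∃ R : ℝ, ∀ r < k, B r ≤ R := by
    refine ⟨∑ r ∈ Finset.range k, B r, fun r hr => ?_⟩
    exact Finset.single_le_sum (f := B) (fun i _ => (abs_nonneg _).trans (hB i 0))
      (Finset.mem_range.2 hr)
  have h2 : ∀ n : ℕ, |A n x - s (n / k)| ≤ (n / k : ℕ) + 1 + R := by
    intro n
    have e : k * (n / k) + n % k = n := Nat.div_add_mod n k
    have h3 := hq (k * (n / k)) (n % k) x
    rw [e] at h3
    have h4 := (hB (n % k) (k * (n / k))).trans (hR _ (Nat.mod_lt _ hk))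
    have h5 := h1 (n / k)
    rw [abs_le] at *
    constructor <;> linarith [h3.1, h3.2, h4.1, h4.2, h5.1, h5.2]
  have hq1 := tendsto_natDiv_div hk
  have hdiv : Tendsto (fun n : ℕ => n / k) atTop atTop := Nat.tendsto_div_const_atTop hk.ne'
  have h3 : Tendsto (fun n : ℕ => s (n / k) / ((n / k : ℕ) : ℝ) * (((n / k : ℕ) : ℝ) / n)) atTop
      (𝓝 (c * (1 / k))) := (hc.comp hdiv).mul hq1
  have h4 : ∀ᶠ n : ℕ in atTop,
      |s (n / k) / ((n / k : ℕ) : ℝ) * (((n / k : ℕ) : ℝ) / n) - c * (1 / k)| < 1 / k := by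
    have := h3.eventually (Metric.ball_mem_nhds _ (ε := 1 / (k : ℝ)) (by positivity))
    simpa [Metric.mem_ball, Real.dist_eq] using this
  have h5 : Tendsto (fun n : ℕ => (1 + R) / (n : ℝ)) atTop (𝓝 0) :=
    tendsto_const_nhds.div_atTop tendsto_natCast_atTop_atTop
  have h6 : ∀ᶠ n : ℕ in atTop, (1 + R) / (n : ℝ) < 1 / k :=
    h5.eventually (gt_mem_nhds (by positivity))
  filter_upwards [h4, h6, eventually_ge_atTop k] with n h4 h6 hn
  have hn0 : (0 : ℝ) < n := by exact_mod_cast hk.trans_le hn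
  have hnk : (0 : ℝ) < ((n / k : ℕ) : ℝ) := by exact_mod_cast Nat.div_pos hn hk
  have h7 : s (n / k) / ((n / k : ℕ) : ℝ) * (((n / k : ℕ) : ℝ) / n) = s (n / k) / n := by
    field_simp
  rw [h7] at h4
  have h8 : |A n x / n - s (n / k) / n| ≤ 1 / k + (1 + R) / n := by
    rw [← sub_div, abs_div, Nat.abs_cast]
    have h9 : ((n / k : ℕ) : ℝ) / n ≤ 1 / k := by
      rw [div_le_div_iff₀ hn0 hk', one_mul]
      exact_mod_cast Nat.div_mul_le_self n k
    calc _ ≤ ((n / k : ℕ) + 1 + R) / (n : ℝ) := by gcongr; exact h2 n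
      _ = ((n / k : ℕ) : ℝ) / n + (1 + R) / n := by ring
      _ ≤ _ := by linarith
  have e3 : (3 : ℝ) / k = 1 / k + 1 / k + 1 / k := by ring
  have e4 : c * (1 / (k : ℝ)) = c / k := by ring
  rw [e4] at h4
  rw [e3]
  rw [abs_le] at *
  rw [abs_lt] at h4
  constructor <;> linarith [h4.1, h4.2, h8.1, h8.2]

lemma quasi_birkhoff {X : Type*} [MeasurableSpace X] {μ : Measure X} [IsFiniteMeasure μ]
    {T : X → X} (hT : MeasurePreserving T μ μ) {A : ℕ → X → ℝ} (hA : ∀ n, Measurable (A n))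
    (hA0 : ∀ x, A 0 x = 0)
    (hq : ∀ n m x, |A (n + m) x - A n x - A m (T^[n] x)| ≤ 1)
    (hbd : ∀ n, ∃ C, ∀ᵐ x ∂μ, |A n x| ≤ C) :
    ∀ᵐ x ∂μ, ∃ L, Tendsto (fun n : ℕ => A n x / n) atTop (𝓝 L) := by
  choose B hB using hbd
  have horb : ∀ᵐ x ∂μ, ∀ r n, |A r (T^[n] x)| ≤ B r := by
    rw [ae_all_iff]; intro r
    rw [ae_all_iff]; intro n
    exact (hT.iterate n).quasiMeasurePreserving.ae (hB r)
  have hbir : ∀ᵐ x ∂μ, ∀ k : ℕ, ∃ c, Tendsto (fun n => birkhoffAverage ℝ (T^[k])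
      (fun y => max (-|B k|) (min |B k| (A k y))) n x) atTop (𝓝 c) := by
    rw [ae_all_iff]; intro k
    refine birkhoff_bounded (hT.iterate k)
      (measurable_const.max (measurable_const.min (hA k))) (C := |B k|) fun y => ?_
    rw [abs_le]
    have := abs_nonneg (B k)
    exact ⟨le_max_left _ _, max_le (by linarith) (min_le_left _ _)⟩
  filter_upwards [horb, hbir] with x h1 h2
  apply exists_tendsto_of_approx
  intro ε hε
  obtain ⟨k, hk⟩ := exists_nat_gt (3 / ε)
  have hk0 : (0 : ℝ) < k := lt_trans (by positivity) hk
  obtain ⟨c, hc⟩ := h2 k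
  refine ⟨c / k, ?_⟩
  have h3 := quasi_approx hA0 hq h1 (k := k) (by exact_mod_cast hk0) (c := c) ?_
  · filter_upwards [h3] with n hn
    refine hn.trans ?_
    rw [div_lt_iff₀ hε] at hk
    rw [div_le_iff₀ hk0]
    linarith
  · refine hc.congr fun n => ?_
    rw [birkhoffAverage, smul_eq_mul, inv_mul_eq_div, birkhoffSum]
    congr 1
    refine Finset.sum_congr rfl fun j _ => ?_
    rw [← Function.iterate_mul]
    have h4 := (h1 k (k * j)).trans (le_abs_self _)
    rw [abs_le] at h4
    rw [min_eq_right h4.2, max_eq_right h4.1]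

end Quasi


section Lift

open unitInterval

/-- Unit vector at angle `s` (in turns) from the vertical. -/
def ev (s : ℝ) : Pl := (-Real.sin (2 * Real.pi * s), Real.cos (2 * Real.pi * s))

/-- Identification of the plane with `ℂ` sending `ev s` to `exp (2 π i s)`. -/
def toC (v : Pl) : ℂ := ⟨v.2, -v.1⟩

lemma continuous_toC : Continuous toC := by
  have : toC = fun v : Pl => (v.2 : ℂ) + (-v.1 : ℝ) * Complex.I := by
    funext v
    apply Complex.ext <;> simp [toC]
  rw [this]
  fun_prop

lemma continuous_ev : Continuous ev := by
  unfold ev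
  fun_prop

lemma toC_ne_zero {v : Pl} (hv : v ≠ 0) : toC v ≠ 0 := by
  intro h
  apply hv
  have h1 := congrArg Complex.re h
  have h2 := congrArg Complex.im h
  simp [toC] at h1 h2
  exact Prod.ext h2 h1

lemma eq_smul_ev_of_toC {v : Pl} {z : ℂ} (h : Complex.exp z = toC v) :
    v = Real.exp z.re • ev (z.im / (2 * Real.pi)) := by
  have h1 := congrArg Complex.re h
  have h2 := congrArg Complex.im h
  rw [Complex.exp_re] at h1
  rw [Complex.exp_im] at h2
  simp only [toC] at h1 h2
  have e : 2 * Real.pi * (z.im / (2 * Real.pi)) = z.im := by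
    field_simp
  simp only [ev, e]
  apply Prod.ext
  · simp; linarith
  · simp; linarith

lemma toC_ev (s : ℝ) : Complex.exp (2 * Real.pi * s * Complex.I) = toC (ev s) := by
  have : (2 * Real.pi * s * Complex.I : ℂ) = ((2 * Real.pi * s : ℝ) : ℂ) * Complex.I := by
    push_cast; ring
  rw [this]
  apply Complex.ext
  · rw [Complex.exp_ofReal_mul_I_re]; simp [toC, ev]
  · rw [Complex.exp_ofReal_mul_I_im]; simp [toC, ev]

lemma ev_ne_zero (s : ℝ) : ev s ≠ 0 := by
  intro h
  have h1 := congrArg toC h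
  rw [← toC_ev] at h1
  have h2 : toC 0 = 0 := by apply Complex.ext <;> simp [toC]
  rw [h2] at h1
  exact Complex.exp_ne_zero _ h1

lemma exists_eq_smul_ev {w : Pl} (hw : w ≠ 0) : ∃ r > (0 : ℝ), ∃ s, w = r • ev s := by
  have h := Complex.exp_log (toC_ne_zero hw)
  exact ⟨Real.exp (Complex.log (toC w)).re, Real.exp_pos _,
    (Complex.log (toC w)).im / (2 * Real.pi), eq_smul_ev_of_toC h⟩

lemma ev_add_int (s : ℝ) (k : ℤ) : ev (s + k) = ev s := by
  have e : 2 * Real.pi * (s + k) = 2 * Real.pi * s + k * (2 * Real.pi) := by ring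
  simp only [ev, e, Real.sin_add_int_mul_two_pi, Real.cos_add_int_mul_two_pi]

lemma exists_int_of_smul_ev {a b r r' : ℝ} (hr : 0 < r) (hr' : 0 < r')
    (h : r • ev a = r' • ev b) : ∃ k : ℤ, a = b + k := by
  have h1 := congrArg Prod.fst h
  have h2 := congrArg Prod.snd h
  simp only [ev, Prod.smul_mk, smul_eq_mul] at h1 h2
  have s1 := Real.sin_sq_add_cos_sq (2 * Real.pi * a)
  have s2 := Real.sin_sq_add_cos_sq (2 * Real.pi * b)
  set A := Real.sin (2 * Real.pi * a)
  set B := Real.sin (2 * Real.pi * b)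
  set A' := Real.cos (2 * Real.pi * a)
  set B' := Real.cos (2 * Real.pi * b)
  have hrr : r = r' := by
    have h3 : r ^ 2 = r' ^ 2 := by
      calc r ^ 2 = (r * -A) ^ 2 + (r * A') ^ 2 := by linear_combination -r ^ 2 * s1
        _ = (r' * -B) ^ 2 + (r' * B') ^ 2 := by rw [h1, h2]
        _ = r' ^ 2 := by linear_combination r' ^ 2 * s2
    exact (pow_left_inj₀ hr.le hr'.le two_ne_zero).1 h3
  subst hrr
  have h4 : A = B := by
    have := mul_left_cancel₀ hr.ne' h1
    linarith
  have h5 : A' = B' := mul_left_cancel₀ hr.ne' h2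
  have h6 : ((2 * Real.pi * a : ℝ) : Real.Angle) = ((2 * Real.pi * b : ℝ) : Real.Angle) :=
    Real.Angle.cos_sin_inj h5 h4
  obtain ⟨k, hk⟩ := Real.Angle.angle_eq_iff_two_pi_dvd_sub.1 h6
  refine ⟨k, ?_⟩
  have hpi : (2 * Real.pi) ≠ 0 := by positivity
  apply mul_left_cancel₀ hpi
  linarith

lemma int_diff_const {u v : ℝ → ℝ} (hu : Continuous u) (hv : Continuous v)
    (h : ∀ t ∈ Icc (0 : ℝ) 1, ∃ k : ℤ, u t = v t + k) {k : ℤ} (h0 : u 0 = v 0 + k) :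
    u 1 = v 1 + k := by
  have hd : IsDiscrete (range ((↑) : ℤ → ℝ)) :=
    Int.isClosedEmbedding_coe_real.isInducing.isDiscrete_range
  have := (isPreconnected_Icc (a := (0 : ℝ)) (b := 1)).constant_of_mapsTo hd
    (f := fun t => u t - v t) (hu.sub hv).continuousOn
    (fun t ht => by obtain ⟨k, hk⟩ := h t ht; exact ⟨k, by linarith⟩)
    (x := 1) (y := 0) (by simp) (by simp)
  linarith

variable (S : IsotopySetup)

lemma fderiv_injective {t : ℝ} (ht : t ∈ Icc (0 : ℝ) 1) (p : Pl) :
    Function.Injective (fderiv ℝ (S.Ft t) p) := by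
  obtain ⟨G, hG, hl, -⟩ := S.Ft_diffeo t ht
  have h1 : DifferentiableAt ℝ (S.Ft t) p := (S.Ft_smooth t ht).differentiable one_ne_zero p
  have h2 : DifferentiableAt ℝ G (S.Ft t p) := hG.differentiable one_ne_zero _
  have h3 : G ∘ S.Ft t = id := funext hl
  have h4 := fderiv_comp p h2 h1
  rw [h3, fderiv_id] at h4
  intro v w hvw
  have h5 := congrArg (fun L : Pl →L[ℝ] Pl => L v) h4
  have h6 := congrArg (fun L : Pl →L[ℝ] Pl => L w) h4
  simp only [ContinuousLinearMap.comp_apply, ContinuousLinearMap.id_apply] at h5 h6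
  rw [h5, h6, hvw]

lemma exists_lift : ∃ Φ : ℝ → ℝ → Pl → ℝ,
    Continuous (fun q : ℝ × ℝ × Pl => Φ q.1 q.2.1 q.2.2) ∧ (∀ s p, Φ 0 s p = s) ∧
    ∀ t ∈ Icc (0 : ℝ) 1, ∀ s p, ∃ r > (0 : ℝ), fderiv ℝ (S.Ft t) p (ev s) = r • ev (Φ t s p) := by
  have hD : Continuous (fun q : I × (ℝ × Pl) => fderiv ℝ (S.Ft q.1) q.2.2 (ev q.2.1)) := by
    have h1 : Continuous (fun q : I × (ℝ × Pl) => fderiv ℝ (S.Ft q.1) q.2.2) := by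
      have := S.DFt_cont.comp_continuous (f := fun q : I × (ℝ × Pl) => ((q.1 : ℝ), q.2.2))
        (by fun_prop) (fun q => ⟨q.1.2, mem_univ _⟩)
      exact this
    exact h1.clm_apply (continuous_ev.comp (by fun_prop))
  have hne : ∀ q : I × (ℝ × Pl), toC (fderiv ℝ (S.Ft q.1) q.2.2 (ev q.2.1)) ≠ 0 := by
    intro q
    apply toC_ne_zero
    intro h
    apply ev_ne_zero q.2.1
    apply fderiv_injective S q.1.2 q.2.2
    rw [h, map_zero]
  let H : C(I × (ℝ × Pl), {z : ℂ // z ≠ 0}) :=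
    ⟨fun q => ⟨_, hne q⟩, (continuous_toC.comp hD).subtype_mk _⟩
  let f0 : C(ℝ × Pl, ℂ) := ⟨fun q => 2 * Real.pi * q.1 * Complex.I, by fun_prop⟩
  have H0 : ∀ a, H (0, a) = ⟨Complex.exp (f0 a), Complex.exp_ne_zero _⟩ := by
    intro a
    apply Subtype.ext
    simp only [H, f0, ContinuousMap.coe_mk, toC_ev]
    congr 1
    simp [S.Ft_zero]
  let Ψ := Complex.isCoveringMap_exp.liftHomotopy H f0 H0
  have hΨ : ∀ q, Complex.exp (Ψ q) = toC (fderiv ℝ (S.Ft q.1) q.2.2 (ev q.2.1)) := by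
    intro q
    have := congrFun (Complex.isCoveringMap_exp.liftHomotopy_lifts H f0 H0) q
    exact congrArg Subtype.val this
  have hΨ0 : ∀ a, Ψ (0, a) = f0 a := Complex.isCoveringMap_exp.liftHomotopy_zero H f0 H0
  refine ⟨fun t s p => (Ψ (projIcc 0 1 zero_le_one t, (s, p))).im / (2 * Real.pi), ?_, ?_, ?_⟩
  · have : Continuous fun q : ℝ × ℝ × Pl =>
        Ψ (projIcc 0 1 zero_le_one q.1, (q.2.1, q.2.2)) :=
      Ψ.continuous.comp ((continuous_projIcc.comp continuous_fst).prodMk (by fun_prop))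
    exact (Complex.continuous_im.comp this).div_const _
  · intro s p
    have e : projIcc (0 : ℝ) 1 zero_le_one 0 = (0 : I) := by simp
    beta_reduce
    rw [e, hΨ0]
    simp [f0]
  · intro t ht s p
    have h := eq_smul_ev_of_toC (hΨ (projIcc 0 1 zero_le_one t, (s, p)))
    beta_reduce
    rw [projIcc_of_mem _ ht] at h ⊢
    exact ⟨_, Real.exp_pos _, h⟩

end Lift


section Dyn

variable (S : IsotopySetup)

/-- The continuous angle function of the linearized isotopy. -/
def Phi : ℝ → ℝ → Pl → ℝ := (exists_lift S).choose

lemma continuous_Phi : Continuous (fun q : ℝ × ℝ × Pl => Phi S q.1 q.2.1 q.2.2) :=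
  (exists_lift S).choose_spec.1

lemma Phi_zero (s : ℝ) (p : Pl) : Phi S 0 s p = s := (exists_lift S).choose_spec.2.1 s p

lemma Phi_spec {t : ℝ} (ht : t ∈ Icc (0 : ℝ) 1) (s : ℝ) (p : Pl) :
    ∃ r > (0 : ℝ), fderiv ℝ (S.Ft t) p (ev s) = r • ev (Phi S t s p) :=
  (exists_lift S).choose_spec.2.2 t ht s p

lemma continuous_Phi_t (s : ℝ) (p : Pl) : Continuous (fun t => Phi S t s p) :=
  (continuous_Phi S).comp (f := fun t : ℝ => (t, s, p)) (by fun_prop)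

/-- The time-one circle map lift in the fiber of `p`. -/
def phi (p : Pl) (s : ℝ) : ℝ := Phi S 1 s p

lemma continuous_phi : Continuous (fun q : Pl × ℝ => phi S q.1 q.2) :=
  (continuous_Phi S).comp (f := fun q : Pl × ℝ => ((1 : ℝ), q.2, q.1)) (by fun_prop)

lemma phi_add_int (p : Pl) (s : ℝ) (k : ℤ) : phi S p (s + k) = phi S p s + k := by
  refine int_diff_const (continuous_Phi_t S (s + k) p) (continuous_Phi_t S s p) ?_ ?_
  · intro t ht
    obtain ⟨r, hr, h⟩ := Phi_spec S ht (s + k) p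
    obtain ⟨r', hr', h'⟩ := Phi_spec S ht s p
    rw [ev_add_int, h'] at h
    exact exists_int_of_smul_ev hr hr' h.symm
  · rw [Phi_zero, Phi_zero]

lemma fderiv_Ft_add (t : ℝ) (p : Pl) :
    fderiv ℝ (S.Ft t) (p + (1, 0)) = fderiv ℝ (S.Ft t) p := by
  rw [← fderiv_comp_add_right]
  have : (fun q => S.Ft t (q + (1, 0))) = fun q => S.Ft t q + (1, 0) :=
    funext (S.Ft_periodic t)
  rw [this, fderiv_add_const]

lemma phi_periodic (p : Pl) (s : ℝ) : phi S (p + (1, 0)) s = phi S p s := by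
  have := int_diff_const (k := 0) (continuous_Phi_t S s (p + (1, 0))) (continuous_Phi_t S s p)
    ?_ ?_
  · simpa [phi] using this
  · intro t ht
    obtain ⟨r, hr, h⟩ := Phi_spec S ht s (p + (1, 0))
    obtain ⟨r', hr', h'⟩ := Phi_spec S ht s p
    rw [fderiv_Ft_add, h'] at h
    exact exists_int_of_smul_ev hr hr' h.symm
  · rw [Phi_zero, Phi_zero]; simp

lemma one_mem : (1 : ℝ) ∈ Icc (0 : ℝ) 1 := by simp

lemma phi_injective (p : Pl) : Function.Injective (phi S p) := by
  intro s s' h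
  obtain ⟨r, hr, h1⟩ := Phi_spec S one_mem s p
  obtain ⟨r', hr', h2⟩ := Phi_spec S one_mem s' p
  have h3 : Phi S 1 s p = Phi S 1 s' p := h
  have h4 : fderiv ℝ (S.Ft 1) p (r' • ev s) = fderiv ℝ (S.Ft 1) p (r • ev s') := by
    rw [map_smul, map_smul, h1, h2, h3, smul_comm]
  obtain ⟨k, hk⟩ := exists_int_of_smul_ev hr' hr (fderiv_injective S one_mem p h4)
  have h5 := phi_add_int S p s' k
  rw [← hk, h] at h5
  have : (k : ℝ) = 0 := by linarith
  rw [hk, this, add_zero]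

lemma phi_strictMono (p : Pl) : StrictMono (phi S p) := by
  have hc : Continuous (phi S p) := (continuous_phi S).comp (f := fun s : ℝ => (p, s)) (by fun_prop)
  rcases hc.strictMono_of_inj (phi_injective S p) with h | h
  · exact h
  · exfalso
    have h1 := h (show (0 : ℝ) < 0 + ((1 : ℤ) : ℝ) by norm_num)
    rw [phi_add_int] at h1
    norm_num at h1

/-- Angle at time `n`, starting from angle `s` above `p`. -/
def theta : ℕ → Pl → ℝ → ℝ
  | 0, _, s => s
  | n + 1, p, s => phi S (S.F^[n] p) (theta n p s)

lemma continuous_F : Continuous S.F := (S.Ft_smooth 1 one_mem).continuous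

lemma theta_continuous (n : ℕ) : Continuous (fun q : Pl × ℝ => theta S n q.1 q.2) := by
  induction n with
  | zero => exact continuous_snd
  | succ n ih =>
    exact (continuous_phi S).comp
      ((((continuous_F S).iterate n).comp continuous_fst).prodMk ih)

lemma theta_add_int (n : ℕ) (p : Pl) (s : ℝ) (k : ℤ) :
    theta S n p (s + k) = theta S n p s + k := by
  induction n with
  | zero => rfl
  | succ n ih => simp only [theta]; rw [ih, phi_add_int]

lemma theta_mono (n : ℕ) (p : Pl) : Monotone (theta S n p) := by
  induction n with
  | zero => exact monotone_id
  | succ n ih => exact (phi_strictMono S _).monotone.comp ih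

lemma theta_add (n m : ℕ) (p : Pl) (s : ℝ) :
    theta S (n + m) p s = theta S m (S.F^[n] p) (theta S n p s) := by
  induction m with
  | zero => rfl
  | succ m ih =>
    rw [← add_assoc]
    simp only [theta]
    rw [ih, ← Function.iterate_add_apply, add_comm m n]

lemma theta_diff (n : ℕ) (p : Pl) (s s' : ℝ) :
    |(theta S n p s - s) - (theta S n p s' - s')| ≤ 1 := by
  have h1 := Int.floor_le (s - s')
  have h2 := Int.lt_floor_add_one (s - s')
  have h3 := theta_mono S n p (show s' + (⌊s - s'⌋ : ℝ) ≤ s by linarith)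
  have h4 := theta_mono S n p (show s ≤ s' + ((⌊s - s'⌋ + 1 : ℤ) : ℝ) by push_cast; linarith)
  rw [theta_add_int] at h3 h4
  push_cast at h4
  rw [abs_le]
  constructor <;> linarith

lemma iterate_F_add (n : ℕ) (p : Pl) : S.F^[n] (p + (1, 0)) = S.F^[n] p + (1, 0) := by
  induction n generalizing p with
  | zero => rfl
  | succ n ih =>
    rw [Function.iterate_succ_apply, Function.iterate_succ_apply, ← ih]
    congr 1
    exact S.Ft_periodic 1 p

lemma theta_periodic (n : ℕ) (p : Pl) (s : ℝ) :
    theta S n (p + (1, 0)) s = theta S n p s := by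
  induction n with
  | zero => rfl
  | succ n ih => simp only [theta]; rw [ih, iterate_F_add, phi_periodic]

lemma theta_periodic_int (n : ℕ) (p : Pl) (s : ℝ) (k : ℤ) :
    theta S n (p + ((k : ℝ), 0)) s = theta S n p s := by
  induction k using Int.induction_on with
  | zero =>
    have h0 : p + (((0 : ℤ) : ℝ), (0 : ℝ)) = p := by ext <;> simp
    rw [h0]
  | succ i ih =>
    rw [← ih, ← theta_periodic S n (p + (((i : ℤ) : ℝ), 0))]
    congr 1
    rw [add_assoc]
    simp
  | pred i ih =>
    rw [← ih, ← theta_periodic S n (p + (((-(i : ℤ) - 1 : ℤ) : ℝ), 0))]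
    congr 1
    rw [add_assoc]
    simp

lemma theta_eq_of_pr (n : ℕ) {p q : Pl} (h : pr p = pr q) (s : ℝ) :
    theta S n p s = theta S n q s := by
  have h1 : (p.1 : AddCircle (1 : ℝ)) = (q.1 : AddCircle (1 : ℝ)) := congrArg (fun z : Ann => z.1) h
  have h2 : p.2 = q.2 := congrArg (fun z : Ann => z.2) h
  have h3 : ((p.1 - q.1 : ℝ) : AddCircle (1 : ℝ)) = 0 := by
    rw [AddCircle.coe_sub, h1, sub_self]
  obtain ⟨k, hk⟩ := (AddCircle.coe_eq_zero_iff (1 : ℝ)).1 h3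
  rw [zsmul_eq_mul, mul_one] at hk
  have h4 : p = q + ((k : ℝ), (0 : ℝ)) := by
    ext
    · simp only [Prod.fst_add]; linarith
    · simp only [Prod.snd_add]; linarith
  rw [h4, theta_periodic_int]

lemma pr_iterate (n : ℕ) (p : Pl) : pr (S.F^[n] p) = S.f^[n] (pr p) := by
  induction n generalizing p with
  | zero => rfl
  | succ n ih =>
    rw [Function.iterate_succ_apply, Function.iterate_succ_apply, ih]
    congr 1
    exact S.lift_f p

lemma D_eq {n : ℕ} {t : ℝ} (ht : t ∈ Icc (n : ℝ) (n + 1)) (p w : Pl) :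
    S.D t p w = fderiv ℝ (S.Ft (t - n)) (S.F^[n] p) (fderiv ℝ (S.F^[n]) p w) := by
  rcases eq_or_lt_of_le ht.2 with h | h
  · have h1 : ⌊t⌋₊ = n + 1 := by
      rw [h]; exact_mod_cast Nat.floor_natCast (n + 1)
    have h2 : Int.fract t = 0 := by
      rw [h]; exact_mod_cast Int.fract_natCast (n + 1)
    have h3 : t - n = 1 := by linarith
    have hF : Differentiable ℝ S.F := (S.Ft_smooth 1 one_mem).differentiable one_ne_zero
    rw [IsotopySetup.D, h1, h2, h3, S.Ft_zero, fderiv_id, ContinuousLinearMap.id_comp,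
      Function.iterate_succ', fderiv_comp p (hF _) (hF.iterate n p)]
    rfl
  · have h0 : 0 ≤ t := (Nat.cast_nonneg n).trans ht.1
    have h1 : ⌊t⌋₊ = n := (Nat.floor_eq_iff h0).2 ⟨ht.1, h⟩
    have h2 : Int.fract t = t - n := by
      rw [← natCast_floor_eq_intCast_floor_aux h0 h1]
    rw [IsotopySetup.D, h1, h2]
    rfl
where
  natCast_floor_eq_intCast_floor_aux {n : ℕ} {t : ℝ} (h0 : 0 ≤ t) (h1 : ⌊t⌋₊ = n) :
      Int.fract t = t - n := by
    rw [Int.fract, ← h1, natCast_floor_eq_intCast_floor h0]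

lemma exists_Theta (p : Pl) {w : Pl} {r s : ℝ} (hr : 0 < r) (hw : w = r • ev s) (n : ℕ) :
    (∃ r > (0 : ℝ), fderiv ℝ (S.F^[n]) p w = r • ev (theta S n p s)) ∧
    ∃ Θ : ℝ → ℝ, ContinuousOn Θ (Icc 0 (n : ℝ)) ∧
      (∀ t ∈ Icc (0 : ℝ) (n : ℝ), ∃ r : ℝ, 0 < r ∧ S.D t p w = r • ev (Θ t)) ∧
      Θ 0 = s ∧ Θ n = theta S n p s := by
  induction n with
  | zero =>
    have h0 : fderiv ℝ (S.F^[0]) p w = w := by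
      rw [Function.iterate_zero, fderiv_id]; rfl
    refine ⟨⟨r, hr, by rw [h0]; exact hw⟩, fun _ => s, continuousOn_const, ?_, rfl, rfl⟩
    intro t ht
    have ht0 : t = 0 := by
      have h1 := ht.1; have h2 := ht.2
      push_cast at h2
      linarith
    subst ht0
    refine ⟨r, hr, ?_⟩
    have h1 := D_eq S (n := 0) (t := 0) (by simp) p w
    rw [h1, h0]
    simp [S.Ft_zero, hw]
  | succ n ih =>
    obtain ⟨⟨r1, hr1, h1⟩, Θ, hΘc, hΘ, hΘ0, hΘn⟩ := ih
    have key : ∀ t ∈ Icc (n : ℝ) (n + 1), ∃ r' : ℝ, 0 < r' ∧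
        S.D t p w = r' • ev (Phi S (t - n) (theta S n p s) (S.F^[n] p)) := by
      intro t ht
      obtain ⟨r2, hr2, h2⟩ := Phi_spec S (t := t - n)
        ⟨by linarith [ht.1], by linarith [ht.2]⟩ (theta S n p s) (S.F^[n] p)
      refine ⟨r1 * r2, mul_pos hr1 hr2, ?_⟩
      rw [D_eq S ht, h1, map_smul, h2, smul_smul]
    constructor
    · have hF : Differentiable ℝ S.F := (S.Ft_smooth 1 one_mem).differentiable one_ne_zero
      obtain ⟨r2, hr2, h2⟩ := Phi_spec S one_mem (theta S n p s) (S.F^[n] p)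
      refine ⟨r1 * r2, mul_pos hr1 hr2, ?_⟩
      rw [Function.iterate_succ', fderiv_comp p (hF _) (hF.iterate n p),
        ContinuousLinearMap.comp_apply, h1, map_smul]
      have h3 : fderiv ℝ S.F (S.F^[n] p) (ev (theta S n p s)) =
        r2 • ev (theta S (n + 1) p s) := h2
      rw [h3, smul_smul]
    · have hn0 : (0 : ℝ) ≤ n := Nat.cast_nonneg n
      refine ⟨fun t => if t ≤ n then Θ t else Phi S (t - n) (theta S n p s) (S.F^[n] p),
        ?_, ?_, ?_, ?_⟩
      · have hsplit : Icc (0 : ℝ) ((n + 1 : ℕ) : ℝ) = Icc 0 (n : ℝ) ∪ Icc (n : ℝ) (n + 1) := by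
          rw [Icc_union_Icc_eq_Icc hn0 (by linarith)]; push_cast; rfl
        rw [hsplit]
        refine ContinuousOn.union_of_isClosed ?_ ?_ isClosed_Icc isClosed_Icc
        · exact hΘc.congr fun t ht => if_pos ht.2
        · have hc : Continuous fun t : ℝ => Phi S (t - n) (theta S n p s) (S.F^[n] p) :=
            (continuous_Phi_t S _ _).comp (by fun_prop)
          refine hc.continuousOn.congr fun t ht => ?_
          by_cases h : t ≤ n
          · have : t = n := le_antisymm h ht.1
            subst this
            simp [hΘn, Phi_zero]
          · exact if_neg h
      · intro t ht
        by_cases h : t ≤ n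
        · simp only [if_pos h]
          exact hΘ t ⟨ht.1, h⟩
        · simp only [if_neg h]
          have h2 := ht.2
          push_cast at h2
          exact key t ⟨(not_le.1 h).le, h2⟩
      · simp only [if_pos hn0, hΘ0]
      · have : ¬ (((n + 1 : ℕ) : ℝ) ≤ n) := by push_cast; linarith
        simp only [if_neg this]
        have e : ((n + 1 : ℕ) : ℝ) - n = 1 := by push_cast; ring
        rw [e]
        rfl

lemma angleVar (p : Pl) {w : Pl} {r s : ℝ} (hr : 0 < r) (hw : w = r • ev s) (n : ℕ) :
    S.AngleVar p w n (theta S n p s - s) := by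
  obtain ⟨-, Θ, h1, h2, h3, h4⟩ := exists_Theta S p hr hw n
  exact ⟨Θ, h1, h2, by rw [h3, h4]⟩

lemma torsionLift_of_tendsto {p : Pl} {L : ℝ}
    (h : Tendsto (fun n : ℕ => theta S n p 0 / n) atTop (𝓝 L)) : S.TorsionLift p L := by
  intro w hw
  obtain ⟨r, hr, s, hs⟩ := exists_eq_smul_ev hw
  refine ⟨fun n => theta S n p s - s, fun n _ => angleVar S p hr hs n, ?_⟩
  have h1 : Tendsto (fun n : ℕ => ((theta S n p s - s) - (theta S n p 0 - 0)) / (n : ℝ)) atTop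
      (𝓝 0) := by
    refine squeeze_zero_norm (a := fun n : ℕ => 1 / (n : ℝ)) (fun n => ?_)
      (tendsto_const_nhds.div_atTop tendsto_natCast_atTop_atTop)
    rw [Real.norm_eq_abs, abs_div, Nat.abs_cast]
    gcongr
    exact theta_diff S n p s 0
  have h2 := h1.add h
  rw [zero_add] at h2
  refine h2.congr fun n => ?_
  ring

/-- A measurable section of the covering projection. -/
def sec (z : Ann) : Pl := ((AddCircle.measurableEquivIco (1 : ℝ) 0 z.1 : ℝ), z.2)

lemma measurable_sec : Measurable sec := by
  refine Measurable.prodMk ?_ measurable_snd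
  exact measurable_subtype_coe.comp
    ((AddCircle.measurableEquivIco (1 : ℝ) 0).measurable.comp measurable_fst)

lemma pr_sec (z : Ann) : pr (sec z) = z := by
  refine Prod.ext ?_ rfl
  exact (AddCircle.equivIco (1 : ℝ) 0).symm_apply_apply z.1

theorem main (μ : Measure Ann) [IsProbabilityMeasure μ]
    (hinv : MeasurePreserving S.f μ μ)
    (hsupp : ∃ K : Set Ann, IsCompact K ∧ μ Kᶜ = 0) :
    ∀ᵐ z ∂μ, ∃ L : ℝ, S.Torsion z L := by
  have hc : ∀ n, Continuous (fun p : Pl => theta S n p 0) := fun n =>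
    (theta_continuous S n).comp (f := fun p : Pl => (p, (0 : ℝ))) (by fun_prop)
  have key := quasi_birkhoff hinv (A := fun n z => theta S n (sec z) 0)
    (fun n => (hc n).measurable.comp measurable_sec) (fun z => rfl) ?_ ?_
  · filter_upwards [key] with z hz
    obtain ⟨L, hL⟩ := hz
    exact ⟨L, sec z, pr_sec z, torsionLift_of_tendsto S hL⟩
  · intro n m z
    have h1 : pr (sec (S.f^[n] z)) = pr (S.F^[n] (sec z)) := by
      rw [pr_sec, pr_iterate, pr_sec]
    rw [theta_eq_of_pr S m h1, theta_add]
    have := theta_diff S m (S.F^[n] (sec z)) (theta S n (sec z) 0) 0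
    rwa [sub_zero] at this
  · intro n
    obtain ⟨K, hK, hK0⟩ := hsupp
    have hQ : IsCompact (Icc (0 : ℝ) 1 ×ˢ (Prod.snd '' K)) :=
      isCompact_Icc.prod (hK.image continuous_snd)
    obtain ⟨C, hC⟩ := hQ.exists_bound_of_continuousOn (hc n).continuousOn
    refine ⟨C, ?_⟩
    have : ∀ᵐ z ∂μ, z ∈ K := hK0
    filter_upwards [this] with z hz
    apply hC
    refine ⟨?_, mem_image_of_mem _ hz⟩
    have := (AddCircle.measurableEquivIco (1 : ℝ) 0 z.1).2
    have h2 : (AddCircle.measurableEquivIco (1 : ℝ) 0 z.1 : ℝ) < 0 + 1 := this.2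
    exact ⟨this.1, by simp only [sec]; linarith⟩

end Dyn


end TorsionAux

/-- For a `C¹` diffeomorphism `f` of the annulus isotopic to the identity
admitting an invariant Borel probability measure `μ` with compact support, the asymptotic
torsion exists at `μ`-almost every point. -/
theorem statement18 (S : IsotopySetup) (μ : Measure Ann) [IsProbabilityMeasure μ]
    (hinv : MeasurePreserving S.f μ μ)
    (hsupp : ∃ K : Set Ann, IsCompact K ∧ μ Kᶜ = 0) :
    ∀ᵐ z ∂μ, ∃ L : ℝ, S.Torsion z L := by
  exact TorsionAux.main S μ hinv hsupp

end
end

section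
/- Let f : 𝔸 → 𝔸 be a positive twist map with no conjugate points, F a lift of f, and z ∈ ℝ² a point whose projection π(z) is not a fixed point of f. Then at least one of the following holds: (1) the sequence (p₁(Fⁿ(z)))_{n∈ℤ} is strictly monotone; (2) there exists n₀ ∈ ℤ such that (p₁(Fⁿ(z)))_{n≤n₀} and (p₁(Fⁿ(z)))_{n≥n₀} are strictly monotone with opposite monotonicity; (3) there exists n₀ ∈ ℤ such that p₁(F^{n₀}(z)) = p₁(F^{n₀+1}(z)) and the sequences (p₁(Fⁿ(z)))_{n≤n₀} and (p₁(Fⁿ(z)))_{n≥n₀+1} are strictly monotone with opposite monotonicity. -/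
noncomputable section

open MeasureTheory Set Filter Topology Function

/-- Topological twist data. -/
structure TW (F G : Pl → Pl) : Prop where
  cF : Continuous F
  cG : Continuous G
  GF : ∀ p, G (F p) = p
  FG : ∀ p, F (G p) = p
  per : ∀ p : Pl, F (p + (1, 0)) = F p + (1, 0)
  mono : ∀ x, StrictMono (fun y => (F (x, y)).1)
  surj : ∀ x, Function.Surjective (fun y => (F (x, y)).1)
  anti : ∀ x, StrictAnti (fun y => (G (x, y)).1)

namespace TW

theorem per_int {F : Pl → Pl} (h : ∀ p : Pl, F (p + (1, 0)) = F p + (1, 0)) (k : ℤ) (x y : ℝ) :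
    F (x + k, y) = F (x, y) + ((k : ℝ), 0) := by
  induction k using Int.induction_on with
  | zero => simp
  | succ n ih =>
    have := h (x + ((n : ℤ) : ℝ), y)
    rw [ih] at this
    have e : ((x + ((n : ℤ) : ℝ), y) : Pl) + (1, 0) = (x + (((n : ℤ) + 1 : ℤ) : ℝ), y) := by
      ext <;> simp [add_assoc]
    rw [e] at this
    rw [this]
    ext <;> simp [add_assoc]
  | pred n ih =>
    have := h (x + ((-(n : ℤ) - 1 : ℤ) : ℝ), y)
    have e : ((x + ((-(n : ℤ) - 1 : ℤ) : ℝ), y) : Pl) + (1, 0) = (x + ((-(n : ℤ) : ℤ) : ℝ), y) := by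
      ext <;> simp; ring
    rw [e, ih] at this
    have e1 := congrArg Prod.fst this
    have e2 := congrArg Prod.snd this
    simp at e1 e2
    ext
    · simp; linarith
    · simp; linarith

variable {F G : Pl → Pl}

theorem perG (h : TW F G) : ∀ p : Pl, G (p + (1, 0)) = G p + (1, 0) := by
  intro p
  have := h.per (G p)
  rw [h.FG] at this
  rw [← this, h.GF]

theorem negc (h : TW F G) : TW (fun p => -F (-p)) (fun p => -G (-p)) where
  cF := (h.cF.comp continuous_neg).neg
  cG := (h.cG.comp continuous_neg).neg
  GF p := by simp [h.GF]
  FG p := by simp [h.FG]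
  per p := by
    have := h.per (-(p + (1, 0)))
    have e : -(p + (1, 0)) + (1, 0) = -p := by abel
    rw [e] at this
    simp only [this]; abel
  mono x a b hab := by
    have := h.mono (-x) (neg_lt_neg hab)
    simp only [Prod.neg_mk, Prod.fst_neg] at *
    linarith
  surj x t := by
    obtain ⟨y, hy⟩ := h.surj (-x) (-t)
    refine ⟨-y, ?_⟩
    simp only [Prod.neg_mk, Prod.fst_neg, neg_neg] at *
    linarith
  anti x a b hab := by
    have := h.anti (-x) (neg_lt_neg hab)
    simp only [Prod.neg_mk, Prod.fst_neg] at *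
    linarith

/-- reflection -/
def rf (p : Pl) : Pl := (-p.1, p.2)

theorem rf_rf (p : Pl) : rf (rf p) = p := by simp [rf]

theorem rf_cont : Continuous rf := by unfold rf; fun_prop

theorem refl (h : TW F G) : TW (fun p => rf (G (rf p))) (fun p => rf (F (rf p))) where
  cF := rf_cont.comp (h.cG.comp rf_cont)
  cG := rf_cont.comp (h.cF.comp rf_cont)
  GF p := by simp [rf_rf, h.FG]
  FG p := by simp [rf_rf, h.GF]
  per p := by
    have := h.perG (rf (p + (1, 0)))
    have e : rf (p + (1, 0)) + (1, 0) = rf p := by ext <;> simp [rf]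
    rw [e] at this
    simp only [this]
    ext <;> simp [rf]
  mono x a b hab := by
    have := h.anti (-x) hab
    simpa [rf] using this
  surj x t := by
    obtain ⟨y, hy⟩ := h.surj (-t) (-x)
    refine ⟨(F (-t, y)).2, ?_⟩
    have e : ((-x, (F (-t, y)).2) : Pl) = F (-t, y) := by ext <;> simp; exact hy.symm
    simp [rf, e, h.GF]
  anti x a b hab := by
    have := h.mono (-x) hab
    simpa [rf] using this

theorem unif1 (h : TW F G) (M : ℝ) : ∃ N : ℝ, ∀ x y, N ≤ y → x + M ≤ (F (x, y)).1 := by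
  have hc : IsCompact (Icc (0:ℝ) 1) := isCompact_Icc
  obtain ⟨N, hN⟩ := hc.elim_directed_cover (fun N : ℝ => {x : ℝ | x + M < (F (x, N)).1})
    (fun N => isOpen_lt (by fun_prop) (by have := h.cF; fun_prop))
    (by
      intro x _
      obtain ⟨y, hy⟩ := h.surj x (x + M + 1)
      refine mem_iUnion.2 ⟨y, ?_⟩
      simp only [mem_ofPred_eq] at *
      linarith)
    (by
      refine directed_of_isDirected_le ?_
      intro a b hab x hx
      exact lt_of_lt_of_le hx ((h.mono x).monotone hab))
  refine ⟨N, fun x y hy => ?_⟩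
  have h1 := hN (show Int.fract x ∈ Icc (0:ℝ) 1 from ⟨Int.fract_nonneg x, (Int.fract_lt_one x).le⟩)
  have h2 := per_int h.per ⌊x⌋ (Int.fract x) N
  rw [Int.fract_add_floor] at h2
  have h3 := (h.mono x).monotone hy
  simp only [h2] at h3
  simp only [mem_ofPred_eq, Prod.fst_add] at *
  have := Int.fract_add_floor x
  linarith

theorem proper2 (h : TW F G) (M : ℝ) : ∃ N : ℝ, ∀ x y, N ≤ |y| → M < |(F (x, y)).2| := by
  have hc : IsCompact (Icc (0:ℝ) 1 ×ˢ Icc (-M) M) := isCompact_Icc.prod isCompact_Icc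
  obtain ⟨C, hC⟩ := (hc.exists_bound_of_continuousOn (f := fun p => (G p).2)
    (by have := h.cG; fun_prop))
  refine ⟨C + 1, fun x y hy => ?_⟩
  by_contra hcon
  push Not at hcon
  have hm := abs_le.1 hcon
  set q := F (x, y) with hq
  have h1 := hC (Int.fract q.1, q.2)
    ⟨⟨Int.fract_nonneg _, (Int.fract_lt_one _).le⟩, hm⟩
  have h2 := per_int h.perG ⌊q.1⌋ (Int.fract q.1) q.2
  rw [Int.fract_add_floor] at h2
  have h3 : G (q.1, q.2) = (x, y) := by rw [hq]; exact h.GF _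
  rw [h3] at h2
  have h4 := congrArg Prod.snd h2
  simp at h4
  rw [← h4, Real.norm_eq_abs] at h1
  linarith

theorem unif2 (h : TW F G) (M : ℝ) : ∃ N : ℝ, ∀ x y, N ≤ y → M ≤ (F (x, y)).2 := by
  obtain ⟨u0, hu0⟩ := h.surj 0 0
  simp only at hu0
  set t0 := (F (0, u0)).2 with ht0
  set M' := max M |t0| with hM'
  have hM1 : M ≤ M' := le_max_left _ _
  have hM2 : |t0| ≤ M' := le_max_right _ _
  obtain ⟨N, hN⟩ := h.proper2 M'
  set N1 := max N 0 with hN1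
  have hS : ∀ x y, N1 ≤ y → M' < |(F (x, y)).2| := fun x y hy =>
    hN x y (le_trans (le_trans (le_max_left _ _) hy) (le_abs_self y))
  obtain ⟨k, hk⟩ := exists_nat_ge (F (0, N1)).1
  obtain ⟨u, hu⟩ := h.surj 0 k
  simp only at hu
  have huN : N1 ≤ u := by
    rw [← (h.mono 0).le_iff_le]
    linarith
  have hp := per_int h.per (-(k:ℤ)) 0 u
  have hw : F (-(k:ℝ), u) = (0, (F (0, u)).2) := by
    have e : ((-(k:ℝ), u) : Pl) = (0 + ((-(k:ℤ) : ℤ) : ℝ), u) := by ext <;> simp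
    rw [e, hp]
    ext <;> simp [hu]
  have g1 : G (0, (F (0, u)).2) = (-(k:ℝ), u) := by rw [← hw, h.GF]
  have g0 : G (0, t0) = (0, u0) := by
    have : ((0, t0) : Pl) = F (0, u0) := by ext <;> simp [hu0, ht0]
    rw [this, h.GF]
  have hge : t0 ≤ (F (0, u)).2 := by
    by_contra hc
    push Not at hc
    have := h.anti 0 hc
    simp only [g1, g0] at this
    have : (0:ℝ) ≤ k := Nat.cast_nonneg k
    linarith
  have hpos : 0 < (F (-(k:ℝ), u)).2 := by
    have h1 := hS (-(k:ℝ)) u huN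
    rw [hw] at h1 ⊢
    simp only at h1 ⊢
    by_contra hc
    push Not at hc
    rw [abs_of_nonpos hc] at h1
    have := neg_abs_le t0
    linarith
  refine ⟨N1, fun x y hy => ?_⟩
  by_contra hc
  push Not at hc
  have h1 := hS x y hy
  have hneg : (F (x, y)).2 < 0 := by
    by_contra hc2
    push Not at hc2
    rw [abs_of_nonneg hc2] at h1
    linarith
  have hpre : IsPreconnected ((univ : Set ℝ) ×ˢ Ici N1) :=
    isPreconnected_univ.prod isPreconnected_Ici
  have := hpre.intermediate_value (f := fun p : Pl => (F p).2) (a := (x, y)) (b := (-(k:ℝ), u))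
    ⟨mem_univ _, hy⟩ ⟨mem_univ _, huN⟩ (by have := h.cF; fun_prop) ⟨hneg.le, hpos.le⟩
  obtain ⟨q, hq, hq0⟩ := this
  have h5 := hS q.1 q.2 hq.2
  simp only at hq0
  rw [show ((q.1, q.2) : Pl) = q from rfl, hq0, abs_zero] at h5
  have := abs_nonneg t0
  linarith

theorem unifn (h : TW F G) (n : ℕ) : ∀ M : ℝ, ∃ N : ℝ, ∀ x y, N ≤ y →
    x + M ≤ (F^[n + 1] (x, y)).1 ∧ M ≤ (F^[n + 1] (x, y)).2 := by
  induction n with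
  | zero =>
    intro M
    obtain ⟨N1, h1⟩ := h.unif1 M
    obtain ⟨N2, h2⟩ := h.unif2 M
    exact ⟨max N1 N2, fun x y hy => ⟨h1 x y (le_trans (le_max_left _ _) hy),
      h2 x y (le_trans (le_max_right _ _) hy)⟩⟩
  | succ n ih =>
    intro M
    obtain ⟨N, hN⟩ := ih M
    obtain ⟨N1, h1⟩ := h.unif1 0
    obtain ⟨N2, h2⟩ := h.unif2 N
    refine ⟨max N1 N2, fun x y hy => ?_⟩
    rw [Function.iterate_succ_apply]
    have a1 := h1 x y (le_trans (le_max_left _ _) hy)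
    have a2 := hN (F (x, y)).1 (F (x, y)).2 (h2 x y (le_trans (le_max_right _ _) hy))
    rw [show (((F (x, y)).1, (F (x, y)).2) : Pl) = F (x, y) from rfl] at a2
    exact ⟨by linarith [a2.1], a2.2⟩

theorem mono_of_inj (h : TW F G) (n : ℕ) (x : ℝ)
    (hinj : Function.Injective (fun y => (F^[n + 1] (x, y)).1)) :
    StrictMono (fun y => (F^[n + 1] (x, y)).1) := by
  have hc : Continuous (fun y => (F^[n + 1] (x, y)).1) := by
    have := h.cF.iterate (n + 1)
    fun_prop
  rcases hc.strictMono_of_inj hinj with h1 | h1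
  · exact h1
  · exfalso
    set v := (F^[n + 1] (x, 0)).1 with hv
    obtain ⟨N, hN⟩ := h.unifn n (v - x + 1)
    have a := (hN x (max N 0) (le_max_left _ _)).1
    have b := h1.antitone (le_max_right N 0)
    linarith

theorem conj_iter (A B : Pl → Pl) (hB : ∀ p, B (B p) = p) (n : ℕ) (p : Pl) :
    (fun p => B (A (B p)))^[n] p = B (A^[n] (B p)) := by
  induction n generalizing p with
  | zero => simp [hB]
  | succ n ih => rw [Function.iterate_succ_apply, ih, Function.iterate_succ_apply, hB]

/-- intermediate value going down -/
theorem reach (h : TW F G) (n : ℕ) (x y t : ℝ) (ht : t ≤ (F^[n + 1] (x, y)).1) :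
    ∃ y', (F^[n + 1] (x, y')).1 = t := by
  obtain ⟨N, hN⟩ := h.negc.unifn n (x - t)
  have a := (hN (-x) N le_rfl).1
  rw [conj_iter F (fun p => -p) (by simp)] at a
  simp only [Prod.neg_mk, neg_neg, Prod.fst_neg] at a
  have hc : Continuous (fun y => (F^[n + 1] (x, y)).1) := by
    have := h.cF.iterate (n + 1)
    fun_prop
  have := mem_range_of_exists_le_of_exists_ge hc ⟨-N, by linarith⟩ ⟨y, ht⟩
  exact this

theorem G_F_iter (h : TW F G) (n : ℕ) (p : Pl) : G^[n] (F^[n] p) = p :=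
  (Function.LeftInverse.iterate (h.GF) n) p

theorem F_G_iter (h : TW F G) (n : ℕ) (p : Pl) : F^[n] (G^[n] p) = p :=
  (Function.LeftInverse.iterate (h.FG) n) p

theorem anti_of_inj (h : TW F G)
    (hinj : ∀ n x, Function.Injective (fun y => (F^[n + 1] (x, y)).1)) (n : ℕ) (x : ℝ) :
    StrictAnti (fun y => (G^[n + 1] (x, y)).1) := by
  have key := h.refl.mono_of_inj n (-x) (by
    intro a b hab
    simp only [conj_iter G rf rf_rf] at hab
    simp only [rf, neg_neg, neg_inj] at hab
    set P := G^[n + 1] (x, a) with hP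
    set Q := G^[n + 1] (x, b) with hQ
    have eP : F^[n + 1] P = (x, a) := h.F_G_iter _ _
    have eQ : F^[n + 1] Q = (x, b) := h.F_G_iter _ _
    have e2 : P.2 = Q.2 := by
      apply hinj n P.1
      simp only
      rw [show ((P.1, P.2) : Pl) = P from rfl, hab, show ((Q.1, Q.2) : Pl) = Q from rfl, eP, eQ]
    have : P = Q := Prod.ext hab e2
    rw [this, eQ] at eP
    exact (congrArg Prod.snd eP).symm)
  intro a b hab
  have := key hab
  simp only [conj_iter G rf rf_rf] at this
  simpa [rf] using this

theorem cross (h : TW F G)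
    (hinj : ∀ n x, Function.Injective (fun y => (F^[n + 1] (x, y)).1))
    (P Q : Pl) (k m : ℕ) (hk : 1 ≤ k) (hkm : k < m) (h0 : P.1 < Q.1)
    (h1 : (F^[k] Q).1 < (F^[k] P).1) : (F^[m] Q).1 < (F^[m] P).1 := by
  by_contra hc
  push Not at hc
  obtain ⟨m, rfl⟩ : ∃ m', m = m' + 1 := ⟨m - 1, by omega⟩
  obtain ⟨k, rfl⟩ : ∃ k', k = k' + 1 := ⟨k - 1, by omega⟩
  obtain ⟨y, hy⟩ := h.reach m Q.1 Q.2 _ hc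
  set R : Pl := (Q.1, y) with hR
  have hyQ : y ≤ Q.2 := by
    rw [← (h.mono_of_inj m Q.1 (hinj m Q.1)).le_iff_le]
    rw [← hR, hy]
    exact hc
  have hRk : (F^[k + 1] R).1 < (F^[k + 1] P).1 :=
    lt_of_le_of_lt ((h.mono_of_inj k Q.1 (hinj k Q.1)).monotone hyQ) h1
  set A := F^[m + 1] P with hA
  set B := F^[m + 1] R with hB
  have gA : G^[m + 1] A = P := h.G_F_iter _ _
  have gB : G^[m + 1] B = R := h.G_F_iter _ _
  obtain ⟨j, hj⟩ : ∃ j, m + 1 = (j + 1) + (k + 1) := ⟨m - k - 1, by omega⟩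
  have gA' : G^[j + 1] A = F^[k + 1] P := by
    have e := Function.iterate_add_apply F (j + 1) (k + 1) P
    rw [hA, hj, e]; exact h.G_F_iter _ _
  have gB' : G^[j + 1] B = F^[k + 1] R := by
    have e := Function.iterate_add_apply F (j + 1) (k + 1) R
    rw [hB, hj, e]; exact h.G_F_iter _ _
  have eA : A = (A.1, A.2) := rfl
  have eB : B = (A.1, B.2) := Prod.ext hy rfl
  rcases lt_trichotomy A.2 B.2 with hl | hl | hl
  · have := h.anti_of_inj hinj m A.1 hl
    simp only [← eA, ← eB, gA, gB] at this
    simp only [hR] at this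
    linarith
  · have : A = B := by rw [eA, eB, hl]
    rw [this, gB] at gA
    rw [← gA] at h0
    simp [hR] at h0
  · have := h.anti_of_inj hinj j A.1 hl
    simp only [← eA, ← eB, gA', gB'] at this
    linarith

end TW

theorem smono_Ici {x : ℤ → ℝ} {a : ℤ} (h : ∀ n, a ≤ n → x n < x (n + 1)) :
    StrictMonoOn x (Ici a) := by
  intro i hi j _ hij
  have : ∀ j, i + 1 ≤ j → x i < x j := by
    intro j hj
    induction j, hj using Int.leInduction with
    | base => exact h i hi
    | succ n hn ih => exact ih.trans (h n (by have : a ≤ i := hi; omega))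
  exact this j (by omega)

theorem smono_Iic {x : ℤ → ℝ} {a : ℤ} (h : ∀ n, n < a → x n < x (n + 1)) :
    StrictMonoOn x (Iic a) := by
  intro i hi j hj hij
  have : ∀ j, i + 1 ≤ j → j ≤ a → x i < x j := by
    intro j hj
    induction j, hj using Int.leInduction with
    | base => intro hh; exact h i (by omega)
    | succ n hn ih => intro hh; exact (ih (by omega)).trans (h n (by omega))
  exact this j (by omega) hj

theorem santi_Ici {x : ℤ → ℝ} {a : ℤ} (h : ∀ n, a ≤ n → x (n + 1) < x n) :
    StrictAntiOn x (Ici a) := by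
  have := smono_Ici (x := fun n => - x n) (a := a) (fun n hn => neg_lt_neg (h n hn))
  intro i hi j hj hij
  exact neg_lt_neg_iff.1 (this hi hj hij)

theorem santi_Iic {x : ℤ → ℝ} {a : ℤ} (h : ∀ n, n < a → x (n + 1) < x n) :
    StrictAntiOn x (Iic a) := by
  have := smono_Iic (x := fun n => - x n) (a := a) (fun n hn => neg_lt_neg (h n hn))
  intro i hi j hj hij
  exact neg_lt_neg_iff.1 (this hi hj hij)

/-- Sign change. -/
theorem sign_change {p : ℤ → Prop} {i j : ℤ} (hij : i < j) (hi : p i) (hj : ¬ p j) :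
    ∃ n, p n ∧ ¬ p (n + 1) := by
  by_contra hc
  push Not at hc
  have : ∀ j, i ≤ j → p j := by
    intro j hj
    induction j, hj using Int.leInduction with
    | base => exact hi
    | succ n hn ih => exact hc n ih
  exact hj (this j hij.le)

/-- The combinatorial core. -/
theorem comb_core (x : ℤ → ℝ)
    (hz : ∀ n, x n = x (n + 1) →
      ((∀ m, n < m → x m < x (m + 1)) ∧ (∀ m, m < n → x (m + 1) < x m)) ∨
      ((∀ m, n < m → x (m + 1) < x m) ∧ (∀ m, m < n → x m < x (m + 1))))
    (h1 : ∀ n j m, n < j → j < m → x n < x (n + 1) → x (j + 1) < x j → x (m + 1) < x m)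
    (h2 : ∀ n j m, n < j → j < m → x (n + 1) < x n → x j < x (j + 1) → x m < x (m + 1)) :
    (StrictMono x ∨ StrictAnti x) ∨
    (∃ n₀ : ℤ, (StrictMonoOn x (Iic n₀) ∧ StrictAntiOn x (Ici n₀)) ∨
      (StrictAntiOn x (Iic n₀) ∧ StrictMonoOn x (Ici n₀))) ∨
    (∃ n₀ : ℤ, x n₀ = x (n₀ + 1) ∧
      ((StrictMonoOn x (Iic n₀) ∧ StrictAntiOn x (Ici (n₀ + 1))) ∨
      (StrictAntiOn x (Iic n₀) ∧ StrictMonoOn x (Ici (n₀ + 1))))) := by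
  by_cases hex : ∃ n, x n = x (n + 1)
  · obtain ⟨n, hn⟩ := hex
    refine Or.inr (Or.inr ⟨n, hn, ?_⟩)
    rcases hz n hn with ⟨a, b⟩ | ⟨a, b⟩
    · exact Or.inr ⟨santi_Iic b, smono_Ici (fun m hm => a m (by omega))⟩
    · exact Or.inl ⟨smono_Iic b, santi_Ici (fun m hm => a m (by omega))⟩
  push Not at hex
  have hlt : ∀ n, ¬ x n < x (n + 1) → x (n + 1) < x n := fun n hn =>
    lt_of_le_of_ne (not_lt.1 hn) (hex n).symm
  by_cases hA : ∀ n, x n < x (n + 1)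
  · exact Or.inl (Or.inl (strictMono_int_of_lt_succ hA))
  by_cases hB : ∀ n, x (n + 1) < x n
  · exact Or.inl (Or.inr (strictAnti_int_of_succ_lt hB))
  push Not at hA hB
  obtain ⟨j, hj⟩ := hA
  obtain ⟨i, hi⟩ := hB
  have hj' := hlt j (not_lt.2 hj)
  have hi' : x i < x (i + 1) := lt_of_le_of_ne hi (hex i)
  refine Or.inr (Or.inl ?_)
  rcases lt_trichotomy i j with hij | hij | hij
  · obtain ⟨n, hn, hn1⟩ := sign_change (p := fun n => x n < x (n + 1)) hij hi' (not_lt.2 hj)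
    have hn1' := hlt _ hn1
    refine ⟨n + 1, Or.inl ⟨smono_Iic fun m hm => ?_, santi_Ici fun m hm => ?_⟩⟩
    · rcases (show m = n ∨ m < n by omega) with rfl | hmn
      · exact hn
      · by_contra hc
        exact hn1 (h2 m n (n + 1) hmn (by omega) (hlt m hc) hn)
    · rcases (show m = n + 1 ∨ n + 1 < m by omega) with rfl | hmn
      · exact hn1'
      · exact h1 n (n + 1) m (by omega) hmn hn hn1'
  · subst hij
    exact absurd hi' (not_lt.2 hj)
  · obtain ⟨n, hn, hn1⟩ := sign_change (p := fun n => x (n + 1) < x n) hij hj' (not_lt.2 hi)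
    have hn1' : x (n + 1) < x (n + 1 + 1) := lt_of_le_of_ne (not_lt.1 hn1) (hex _)
    refine ⟨n + 1, Or.inr ⟨santi_Iic fun m hm => ?_, smono_Ici fun m hm => ?_⟩⟩
    · rcases (show m = n ∨ m < n by omega) with rfl | hmn
      · exact hn
      · by_contra hc
        exact hn1 (h1 m n (n + 1) hmn (by omega) (lt_of_le_of_ne (not_lt.1 hc) (hex _)) hn)
    · rcases (show m = n + 1 ∨ n + 1 < m by omega) with rfl | hmn
      · exact hn1'
      · exact h2 n (n + 1) m (by omega) hmn hn hn1'

theorem det_id (L K : Pl →L[ℝ] Pl) (h : ∀ v, K (L v) = v) :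
    (((L (1, 0)).1 * (L (0, 1)).2 - (L (0, 1)).1 * (L (1, 0)).2) *
      ((K (1, 0)).1 * (K (0, 1)).2 - (K (0, 1)).1 * (K (1, 0)).2) = 1) ∧
    (K (0, 1)).1 * ((L (1, 0)).1 * (L (0, 1)).2 - (L (0, 1)).1 * (L (1, 0)).2) =
      - (L (0, 1)).1 := by
  have hK : ∀ v : Pl, K v = v.1 • K (1, 0) + v.2 • K (0, 1) := by
    intro v
    rw [← map_smul, ← map_smul, ← map_add]
    congr 1
    ext <;> simp
  have e1 := h (1, 0)
  have e2 := h (0, 1)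
  rw [hK] at e1 e2
  have a1 := congrArg Prod.fst e1
  have a2 := congrArg Prod.snd e1
  have b1 := congrArg Prod.fst e2
  have b2 := congrArg Prod.snd e2
  simp only [Prod.fst_add, Prod.snd_add, Prod.smul_fst, Prod.smul_snd, smul_eq_mul] at a1 a2 b1 b2
  generalize (L (1, 0)).1 = b at *
  generalize (L (1, 0)).2 = d at *
  generalize (L (0, 1)).1 = a at *
  generalize (L (0, 1)).2 = c at *
  generalize (K (1, 0)).1 = p at *
  generalize (K (1, 0)).2 = q at *
  generalize (K (0, 1)).1 = r at *
  generalize (K (0, 1)).2 = s at *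
  constructor
  · linear_combination (a * q + c * s) * a1 - (a * p + c * r) * a2 + b2
  · linear_combination b * b1 - a * a1

theorem fderiv_linv {A B : Pl → Pl} (hA : ContDiff ℝ 1 A) (hB : ContDiff ℝ 1 B)
    (h : ∀ p, B (A p) = p) (p v : Pl) : fderiv ℝ B (A p) (fderiv ℝ A p v) = v := by
  have dA : DifferentiableAt ℝ A p := (hA.differentiable one_ne_zero).differentiableAt
  have dB : DifferentiableAt ℝ B (A p) := (hB.differentiable one_ne_zero).differentiableAt
  have e : B ∘ A = id := funext h
  have := fderiv_comp p dB dA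
  rw [e, fderiv_id] at this
  rw [← ContinuousLinearMap.comp_apply, ← this]
  rfl

theorem det_pos (S : IsotopySetup) (p : Pl) :
    0 < (fderiv ℝ S.F p (1, 0)).1 * (fderiv ℝ S.F p (0, 1)).2 -
      (fderiv ℝ S.F p (0, 1)).1 * (fderiv ℝ S.F p (1, 0)).2 := by
  set δ : ℝ → ℝ := fun t => (fderiv ℝ (S.Ft t) p (1, 0)).1 * (fderiv ℝ (S.Ft t) p (0, 1)).2 -
      (fderiv ℝ (S.Ft t) p (0, 1)).1 * (fderiv ℝ (S.Ft t) p (1, 0)).2 with hδ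
  change 0 < δ 1
  have hc : ContinuousOn (fun t => fderiv ℝ (S.Ft t) p) (Icc 0 1) :=
    S.DFt_cont.comp (f := fun t : ℝ => ((t, p) : ℝ × Pl)) (by fun_prop)
      (fun t ht => ⟨ht, mem_univ _⟩)
  have hcv : ∀ v : Pl, ContinuousOn (fun t => fderiv ℝ (S.Ft t) p v) (Icc 0 1) := fun v =>
    hc.clm_apply continuousOn_const
  have hδc : ContinuousOn δ (Icc 0 1) := by
    have a := hcv (1, 0)
    have b := hcv (0, 1)
    exact (a.fst.mul b.snd).sub (b.fst.mul a.snd)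
  have h0 : δ 0 = 1 := by
    simp [hδ, S.Ft_zero]
  have hne : ∀ t ∈ Icc (0:ℝ) 1, δ t ≠ 0 := by
    intro t ht h
    obtain ⟨G, hG, hl, _⟩ := S.Ft_diffeo t ht
    have := (det_id _ _ (fderiv_linv (S.Ft_smooth t ht) hG hl p)).1
    simp only [hδ] at h
    rw [h, zero_mul] at this
    exact zero_ne_one this
  by_contra hcon
  push Not at hcon
  have := isPreconnected_Icc.intermediate_value (f := δ) (right_mem_Icc.2 zero_le_one)
    (left_mem_Icc.2 zero_le_one) hδc
  obtain ⟨t, ht, h⟩ := this ⟨hcon, by rw [h0]; exact zero_le_one⟩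
  exact hne t ht h

theorem hasDeriv_vert {A : Pl → Pl} (hA : ContDiff ℝ 1 A) (x y : ℝ) :
    HasDerivAt (fun y => (A (x, y)).1) (fderiv ℝ A (x, y) (0, 1)).1 y := by
  have dA : HasFDerivAt A (fderiv ℝ A (x, y)) (x, y) :=
    (hA.differentiable one_ne_zero).differentiableAt.hasFDerivAt
  have h1 : HasDerivAt (fun y : ℝ => ((x, y) : Pl)) (0, 1) y :=
    (hasDerivAt_const y x).prodMk (hasDerivAt_id y)
  have h2 := dA.comp_hasDerivAt y h1
  exact (ContinuousLinearMap.fst ℝ ℝ ℝ).hasFDerivAt.comp_hasDerivAt y h2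

theorem contDiff_iter {A : Pl → Pl} (hA : ContDiff ℝ 1 A) (n : ℕ) : ContDiff ℝ 1 (A^[n]) := by
  induction n with
  | zero => exact contDiff_id
  | succ n ih => rw [Function.iterate_succ]; exact ih.comp hA

theorem exists_TW (S : IsotopySetup) (htwist : S.PosTwist) : ∃ G, TW S.F G := by
  have h1 : (1:ℝ) ∈ Icc (0:ℝ) 1 := right_mem_Icc.2 zero_le_one
  obtain ⟨G, hG, hl, hr⟩ := S.Ft_diffeo 1 h1
  have hF : ContDiff ℝ 1 S.F := S.Ft_smooth 1 h1
  refine ⟨G, hF.continuous, hG.continuous, hl, hr, S.Ft_periodic 1, fun x => (htwist x).1,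
    fun x => (htwist x).2.1, fun x => ?_⟩
  apply strictAnti_of_deriv_neg
  intro y
  rw [(hasDeriv_vert hG x y).deriv]
  set w := G (x, y) with hw
  have e : S.F w = (x, y) := hr _
  have hd := (det_id _ _ (fderiv_linv hF hG hl w)).2
  rw [e] at hd
  have ha := (htwist w.1).2.2 w.2
  rw [(hasDeriv_vert hF w.1 w.2).deriv] at ha
  change 0 < (fderiv ℝ S.F w (0, 1)).1 at ha
  have hp := det_pos S w
  by_contra hc
  push Not at hc
  have := mul_nonneg hc hp.le
  rw [hd] at this
  linarith

theorem inj_of_nc (S : IsotopySetup) (hnc : S.NoConjPts) (n : ℕ) (x : ℝ) :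
    Function.Injective (fun y => (S.F^[n + 1] (x, y)).1) := by
  have hF : ContDiff ℝ 1 S.F := S.Ft_smooth 1 (right_mem_Icc.2 zero_le_one)
  have hFn := contDiff_iter hF (n + 1)
  have key : ∀ a b : ℝ, a < b → (S.F^[n + 1] (x, a)).1 ≠ (S.F^[n + 1] (x, b)).1 := by
    intro a b hab he
    obtain ⟨c, _, hc⟩ := exists_hasDerivAt_eq_zero (f := fun y => (S.F^[n + 1] (x, y)).1) hab
      (by have := hFn.continuous; fun_prop) he (fun y _ => hasDeriv_vert hFn x y)
    exact hnc (x, c) (n + 1) (by omega) hc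
  intro a b hab
  rcases lt_trichotomy a b with h | h | h
  · exact absurd hab (key a b h)
  · exact h
  · exact absurd hab.symm (key b a h)

theorem iterZ_succ {F G : Pl → Pl} (h : TW F G) (n : ℤ) (z : Pl) :
    iterZ F (n + 1) z = F (iterZ F n z) := by
  have hinv : Function.RightInverse (Function.invFun F) F :=
    Function.rightInverse_invFun (fun p => ⟨G p, h.FG p⟩)
  cases n with
  | ofNat n => exact Function.iterate_succ_apply' F n z
  | negSucc n =>
    cases n with
    | zero => exact (hinv z).symm
    | succ n =>
      change (Function.invFun F)^[n + 1] z = F ((Function.invFun F)^[n + 1 + 1] z)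
      rw [Function.iterate_succ_apply' _ (n + 1), hinv]

theorem iterZ_add {F G : Pl → Pl} (h : TW F G) (n : ℤ) (k : ℕ) (z : Pl) :
    iterZ F (n + k) z = F^[k] (iterZ F n z) := by
  induction k with
  | zero => simp
  | succ k ih =>
    rw [Function.iterate_succ_apply', ← ih, ← iterZ_succ h]
    congr 1
    push_cast
    ring

/-- For a positive twist map with no conjugate points and a lifted point `z`
whose projection is not fixed by `f`, the full orbit sequence `(p₁(Fⁿ(z)))_{n∈ℤ}` is either
(1) strictly monotone, or (2) strictly monotone with opposite monotonicities on `(-∞, n₀]`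
and `[n₀, ∞)` for some `n₀`, or (3) satisfies `p₁(F^{n₀}(z)) = p₁(F^{n₀+1}(z))` and is
strictly monotone with opposite monotonicities on `(-∞, n₀]` and `[n₀+1, ∞)`. -/
theorem statement19 (S : IsotopySetup) (htwist : S.PosTwist) (hnc : S.NoConjPts)
    (z : Pl) (hz : S.f (pr z) ≠ pr z) :
    (StrictMono (fun n : ℤ => (iterZ S.F n z).1) ∨
      StrictAnti (fun n : ℤ => (iterZ S.F n z).1)) ∨
    (∃ n₀ : ℤ,
      (StrictMonoOn (fun n : ℤ => (iterZ S.F n z).1) (Iic n₀) ∧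
        StrictAntiOn (fun n : ℤ => (iterZ S.F n z).1) (Ici n₀)) ∨
      (StrictAntiOn (fun n : ℤ => (iterZ S.F n z).1) (Iic n₀) ∧
        StrictMonoOn (fun n : ℤ => (iterZ S.F n z).1) (Ici n₀))) ∨
    (∃ n₀ : ℤ, (iterZ S.F n₀ z).1 = (iterZ S.F (n₀ + 1) z).1 ∧
      ((StrictMonoOn (fun n : ℤ => (iterZ S.F n z).1) (Iic n₀) ∧
        StrictAntiOn (fun n : ℤ => (iterZ S.F n z).1) (Ici (n₀ + 1))) ∨
      (StrictAntiOn (fun n : ℤ => (iterZ S.F n z).1) (Iic n₀) ∧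
        StrictMonoOn (fun n : ℤ => (iterZ S.F n z).1) (Ici (n₀ + 1))))) := by
  obtain ⟨G, h⟩ := exists_TW S htwist
  have hinj := inj_of_nc S hnc
  set a : ℤ → Pl := fun n => iterZ S.F n z with ha
  have hs : ∀ n, a (n + 1) = S.F (a n) := fun n => iterZ_succ h n z
  have hadd : ∀ n m, n ≤ m → a m = S.F^[(m - n).toNat] (a n) := by
    intro n m hnm
    have := iterZ_add h n (m - n).toNat z
    rw [show n + ((m - n).toNat : ℤ) = m by omega] at this
    exact this
  have hback : ∀ n m, n ≤ m → a n = G^[(m - n).toNat] (a m) := by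
    intro n m hnm
    rw [hadd n m hnm, h.G_F_iter]
  have hne0 : S.F z ≠ z := by
    intro hc
    apply hz
    rw [← S.lift_f]
    exact congrArg pr hc
  have hFi : Function.Injective S.F := Function.LeftInverse.injective h.GF
  have hne : ∀ n, a (n + 1) ≠ a n := by
    have hz0 : a (0 + 1) ≠ a 0 := by rw [hs]; exact hne0
    intro n hc
    rcases le_total n 0 with hn | hn
    · apply hz0
      rw [hadd (n + 1) (0 + 1) (by omega), hadd n 0 hn, hc]
      congr 2
      omega
    · apply hz0
      rw [hback (0 + 1) (n + 1) (by omega), hback 0 n hn, hc]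
      congr 2
      omega
  have fwd : ∀ (n i j : ℤ), n < i → (a (n)).1 = (a (j)).1 → (a n).2 < (a j).2 →
      (a i).1 < (a (j + (i - n))).1 := by
    intro n i j hni e1 e2
    rw [hadd n i hni.le, hadd j (j + (i - n)) (by omega)]
    obtain ⟨k, hk⟩ : ∃ k, (i - n).toNat = k + 1 := ⟨(i - n).toNat - 1, by omega⟩
    rw [show j + (i - n) - j = i - n by ring, hk]
    have := h.mono_of_inj k (a n).1 (hinj k _) e2
    simp only at this
    rwa [show (((a n).1, (a j).2) : Pl) = a j from Prod.ext e1 rfl] at this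
  have bwd : ∀ (n i j : ℤ), i < n → (a (n)).1 = (a (j)).1 → (a n).2 < (a j).2 →
      (a (j + (i - n))).1 < (a i).1 := by
    intro n i j hni e1 e2
    rw [hback i n hni.le, hback (j + (i - n)) j (by omega)]
    obtain ⟨k, hk⟩ : ∃ k, (n - i).toNat = k + 1 := ⟨(n - i).toNat - 1, by omega⟩
    rw [show j - (j + (i - n)) = n - i by ring, hk]
    have := h.anti_of_inj hinj k (a n).1 e2
    simp only at this
    rwa [show (((a n).1, (a j).2) : Pl) = a j from Prod.ext e1 rfl] at this
  have crs : ∀ n' n j m : ℤ, n < j → j < m → (a n).1 < (a n').1 →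
      (a (n' + (j - n))).1 < (a j).1 → (a (n' + (m - n))).1 < (a m).1 := by
    intro n' n j m hnj hjm e0 e1
    rw [hadd n j hnj.le, hadd n' _ (show n' ≤ n' + (j - n) by omega),
      show n' + (j - n) - n' = j - n by ring] at e1
    rw [hadd n m (by omega), hadd n' _ (show n' ≤ n' + (m - n) by omega),
      show n' + (m - n) - n' = m - n by ring]
    exact h.cross hinj _ _ _ _ (by omega) (by omega) e0 e1
  refine comb_core (fun n => (a n).1) ?_ ?_ ?_
  · intro n hn
    rcases lt_trichotomy (a n).2 (a (n + 1)).2 with hl | hl | hl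
    · left
      constructor
      · intro m hm
        have := fwd n m (n + 1) hm hn hl
        rwa [show n + 1 + (m - n) = m + 1 by ring] at this
      · intro m hm
        have := bwd n m (n + 1) hm hn hl
        rwa [show n + 1 + (m - n) = m + 1 by ring] at this
    · exact absurd (Prod.ext hn hl).symm (hne n)
    · right
      constructor
      · intro m hm
        have := fwd (n + 1) (m + 1) n (by omega) hn.symm hl
        rwa [show n + (m + 1 - (n + 1)) = m by ring] at this
      · intro m hm
        have := bwd (n + 1) (m + 1) n (by omega) hn.symm hl
        rwa [show n + (m + 1 - (n + 1)) = m by ring] at this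
  · intro n j m hnj hjm e0 e1
    have := crs (n + 1) n j m hnj hjm e0
    rw [show n + 1 + (j - n) = j + 1 by ring, show n + 1 + (m - n) = m + 1 by ring] at this
    exact this e1
  · intro n j m hnj hjm e0 e1
    have := crs n (n + 1) (j + 1) (m + 1) (by omega) (by omega) e0
    rw [show n + (j + 1 - (n + 1)) = j by ring, show n + (m + 1 - (n + 1)) = m by ring] at this
    exact this e1


end
end
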